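/- (Lemma 4.5, 1D case, d = 1.) Suppose k ≥ 1 (k > d/2) and the Runge–Kutta order r ≥ 2 (r > d/2 + 1), the partition is quasi-uniform, τ ≤ C_CFL h^κ with κ ≥ 1, and ‖u_h^{n,ℓ} − avg(u_h^{n,ℓ})‖_{L∞(Ω)} ≥ c₀ > 0 for all stages. If ‖ξ_σ^n‖_{L²(Ω)} ≤ C⋆⋆ (h^{k+1} + τ^r), then there exist constants C and C̄⋆⋆ (with C̄⋆⋆ depending on C⋆⋆) such that whenever h ≤ C̄⋆⋆, one has ‖ξ_σ^{n,ℓ}‖_{L²(Ω)} ≤ C (h^{k+1} + τ^r) and ‖ξ^{n,ℓ}‖_{L∞(Ω)} ≤ h for all 1 ≤ ℓ ≤ s. -/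

import Mathlib

open Polynomial Finset MeasureTheory

namespace OEDG

variable {N : ℕ}

/-- `pt` lists the nodes `x_{1/2} < x_{3/2} < … < x_{N+1/2}` of a partition of `Ω = [0,1]`. -/
def IsMesh (pt : Fin (N+1) → ℝ) : Prop :=
  pt 0 = 0 ∧ pt (Fin.last N) = 1 ∧ StrictMono pt

/-- Left endpoint of cell `j`. -/
def ptL (pt : Fin (N+1) → ℝ) (j : Fin N) : ℝ := pt j.castSucc

/-- Right endpoint of cell `j`. -/
def ptR (pt : Fin (N+1) → ℝ) (j : Fin N) : ℝ := pt j.succ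

/-- Length `h_j` of cell `j`. -/
def cellh (pt : Fin (N+1) → ℝ) (j : Fin N) : ℝ := ptR pt j - ptL pt j

/-- Maximal mesh size `h`. -/
noncomputable def meshSize (pt : Fin (N+1) → ℝ) : ℝ := ⨆ j : Fin N, cellh pt j

/-- Quasi-uniformity of the partition: `h ≤ γ h_j` for all `j`. -/
def QuasiUniform (pt : Fin (N+1) → ℝ) (γ : ℝ) : Prop :=
  ∀ j : Fin N, meshSize pt ≤ γ * cellh pt j

/-- Membership in `V^k`: every cell polynomial has degree at most `k`. -/
def MemVk (k : ℕ) (u : Fin N → Polynomial ℝ) : Prop :=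
  ∀ j, (u j).natDegree ≤ k

/-- Cellwise `L²` inner product. -/
noncomputable def cip (pt : Fin (N+1) → ℝ) (j : Fin N) (p q : Polynomial ℝ) : ℝ :=
  ∫ x in (ptL pt j)..(ptR pt j), p.eval x * q.eval x

/-- Global `L²(Ω)` inner product of piecewise polynomials. -/
noncomputable def ip (pt : Fin (N+1) → ℝ) (u v : Fin N → Polynomial ℝ) : ℝ :=
  ∑ j : Fin N, cip pt j (u j) (v j)

/-- Cellwise `L²` norm. -/
noncomputable def cl2 (pt : Fin (N+1) → ℝ) (j : Fin N) (p : Polynomial ℝ) : ℝ :=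
  Real.sqrt (cip pt j p p)

/-- Global `L²(Ω)` norm of a piecewise polynomial. -/
noncomputable def l2 (pt : Fin (N+1) → ℝ) (u : Fin N → Polynomial ℝ) : ℝ :=
  Real.sqrt (ip pt u u)

/-- Average `avg(u) = (1/|Ω|) ∫_Ω u dx` (here `|Ω| = 1`). -/
noncomputable def avg (pt : Fin (N+1) → ℝ) (u : Fin N → Polynomial ℝ) : ℝ :=
  ∑ j : Fin N, ∫ x in (ptL pt j)..(ptR pt j), (u j).eval x

/-- `‖u - c‖_{L∞(Ω)}` for a piecewise polynomial `u` and a constant `c`. -/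
noncomputable def linfSub (pt : Fin (N+1) → ℝ) (u : Fin N → Polynomial ℝ) (c : ℝ) : ℝ :=
  ⨆ j : Fin N, sSup ((fun x => |(u j).eval x - c|) '' Set.Icc (ptL pt j) (ptR pt j))

/-- `m`-th derivative of a polynomial. -/
noncomputable def pderiv (m : ℕ) (p : Polynomial ℝ) : Polynomial ℝ :=
  (fun q : Polynomial ℝ => Polynomial.derivative q)^[m] p

/-- Jump `[∂_x^m u]_{j+1/2}` of the `m`-th derivative at the interface to the right of
cell `j`, with periodic identification of `x_{N+1/2}` with `x_{1/2}`. -/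
noncomputable def jumpD [NeZero N] (pt : Fin (N+1) → ℝ) (u : Fin N → Polynomial ℝ)
    (m : ℕ) (j : Fin N) : ℝ :=
  (pderiv m (u (j+1))).eval (pt (Fin.castSucc (j+1))) - (pderiv m (u j)).eval (pt j.succ)

/-- The scale-invariant damping coefficient `σ_j^m(u)` of the OEDG method. -/
noncomputable def sigma [NeZero N] (k : ℕ) (pt : Fin (N+1) → ℝ)
    (u : Fin N → Polynomial ℝ) (m : ℕ) (j : Fin N) : ℝ :=
  if ∀ i, u i = Polynomial.C (avg pt u) then 0
  else (2*(m:ℝ)+1) * (cellh pt j)^m / ((2*(k:ℝ)-1) * (Nat.factorial m)) *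
    ((|jumpD pt u m (j-1)| + |jumpD pt u m j|) / (2 * linfSub pt u (avg pt u)))

/-- Damping rate `δ_j^m = β_j σ_j^m(u) / h_j`. -/
noncomputable def dampRate [NeZero N] (k : ℕ) (pt : Fin (N+1) → ℝ) (β : Fin N → ℝ)
    (u : Fin N → Polynomial ℝ) (m : ℕ) (j : Fin N) : ℝ :=
  β j * sigma k pt u m j / cellh pt j

/-- `Pc j d` is the cellwise `L²(I_j)`-orthogonal projection onto `ℙ^d(I_j)`.
(The family `Pc` realizes the global projections `P^d` onto `V^d`.) -/
def IsCellProj (pt : Fin (N+1) → ℝ)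
    (Pc : Fin N → ℕ → Polynomial ℝ → Polynomial ℝ) : Prop :=
  ∀ (j : Fin N) (dd : ℕ) (p : Polynomial ℝ), (Pc j dd p).natDegree ≤ dd ∧
    ∀ q : Polynomial ℝ, q.natDegree ≤ dd → cip pt j (p - Pc j dd p) q = 0

/-- `w` solves the damping initial value problem with initial data `u`:
`d/dt̂ ∫_{I_j} u_σ v dx + ∑_{m=0}^k (β_j σ_j^m(u)/h_j) ∫_{I_j} (u_σ - P^{m-1} u_σ) v dx = 0`
for every `v ∈ ℙ^k(I_j)` and every `j`, with `u_σ(·,0) = u`.  (Note `m - 1` is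
truncated ℕ-subtraction, which realizes the convention `P^{-1} = P^0`.) -/
def IsDampingSol [NeZero N] (k : ℕ) (pt : Fin (N+1) → ℝ) (β : Fin N → ℝ)
    (Pc : Fin N → ℕ → Polynomial ℝ → Polynomial ℝ)
    (u : Fin N → Polynomial ℝ) (w : ℝ → Fin N → Polynomial ℝ) : Prop :=
  w 0 = u ∧ (∀ t j, (w t j).natDegree ≤ k) ∧
  ∀ (t : ℝ) (j : Fin N) (v : Polynomial ℝ), v.natDegree ≤ k →
    HasDerivAt (fun s => cip pt j (w s j) v)
      (-(∑ m ∈ Finset.range (k+1),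
        dampRate k pt β u m j * cip pt j (w t j - Pc j (m-1) (w t j)) v)) t

/-- `Fτ` is the OE (oscillation-eliminating) operator: for every `u ∈ V^k` the damping
initial value problem has a solution `w` and `Fτ u = w τ`. -/
def IsOEOp [NeZero N] (k : ℕ) (pt : Fin (N+1) → ℝ) (β : Fin N → ℝ)
    (Pc : Fin N → ℕ → Polynomial ℝ → Polynomial ℝ) (τ : ℝ)
    (Fτ : (Fin N → Polynomial ℝ) → (Fin N → Polynomial ℝ)) : Prop :=
  ∀ u, MemVk k u → ∃ w, IsDampingSol k pt β Pc u w ∧ Fτ u = w τ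

/-- Right-hand side of the weak form of the upwind DG operator for `u_t + β u_x = 0`:
`β ∫_{I_j} w v_x dx - β w(x_{j+1/2}^-) v(x_{j+1/2}^-) + β w(x_{j-1/2}^-) v(x_{j-1/2}^+)`. -/
noncomputable def dgRHS [NeZero N] (pt : Fin (N+1) → ℝ) (β : ℝ)
    (w : Fin N → Polynomial ℝ) (j : Fin N) (v : Polynomial ℝ) : ℝ :=
  β * (∫ x in (ptL pt j)..(ptR pt j), (w j).eval x * (Polynomial.derivative v).eval x)
  - β * (w j).eval (ptR pt j) * v.eval (ptR pt j)
  + β * (w (j-1)).eval (pt (j-1).succ) * v.eval (ptL pt j)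

/-- `L` is the upwind DG spatial operator on `V^k`. -/
def IsDGOp [NeZero N] (k : ℕ) (pt : Fin (N+1) → ℝ) (β : ℝ)
    (L : (Fin N → Polynomial ℝ) → (Fin N → Polynomial ℝ)) : Prop :=
  ∀ w, MemVk k w → MemVk k (L w) ∧
    ∀ (j : Fin N) (v : Polynomial ℝ), v.natDegree ≤ k →
      cip pt j (L w j) v = dgRHS pt β w j v

/-- The upwind DG bilinear form
`H(w,v) = β ∑_j ∫_{I_j} w v_x dx + β ∑_j w(x_{j+1/2}^-) [v]_{j+1/2}`. -/
noncomputable def Hform [NeZero N] (pt : Fin (N+1) → ℝ) (β : ℝ)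
    (w v : Fin N → Polynomial ℝ) : ℝ :=
  β * ∑ j : Fin N, (∫ x in (ptL pt j)..(ptR pt j),
      (w j).eval x * (Polynomial.derivative (v j)).eval x)
  + β * ∑ j : Fin N, (w j).eval (ptR pt j) * jumpD pt v 0 j

/-- The upwind DG bilinear form with piecewise-smooth first argument. -/
noncomputable def HformF [NeZero N] (pt : Fin (N+1) → ℝ) (β : ℝ)
    (w : Fin N → ℝ → ℝ) (v : Fin N → Polynomial ℝ) : ℝ :=
  β * ∑ j : Fin N, (∫ x in (ptL pt j)..(ptR pt j),
      w j x * (Polynomial.derivative (v j)).eval x)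
  + β * ∑ j : Fin N, w j (ptR pt j) * jumpD pt v 0 j

/-- `L²(Ω)` pairing of a piecewise-smooth function with a piecewise polynomial. -/
noncomputable def ipF (pt : Fin (N+1) → ℝ) (w : Fin N → ℝ → ℝ)
    (v : Fin N → Polynomial ℝ) : ℝ :=
  ∑ j : Fin N, ∫ x in (ptL pt j)..(ptR pt j), w j x * (v j).eval x

/-- One Runge–Kutta stage: `∑_{0≤m≤ℓ} (c_{ℓm} u_σ^{n,m} + τ d_{ℓm} L(u_σ^{n,m}))`. -/
noncomputable def rkStage [NeZero N] (c d : ℕ → ℕ → ℝ) (τ : ℝ)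
    (L : (Fin N → Polynomial ℝ) → (Fin N → Polynomial ℝ))
    (uσ : ℕ → Fin N → Polynomial ℝ) (ℓ : ℕ) : Fin N → Polynomial ℝ :=
  fun j => ∑ m ∈ Finset.range (ℓ+1),
    (Polynomial.C (c ℓ m) * uσ m j + Polynomial.C (τ * d ℓ m) * L (uσ m) j)

/-- One full OEDG time step from `u_σ^n = un`: the stages `u_h^{n,ℓ+1}` and
`u_σ^{n,ℓ+1} = F_τ u_h^{n,ℓ+1}`, `0 ≤ ℓ ≤ s-1`. -/
def IsOEDGStep [NeZero N] (s : ℕ) (c d : ℕ → ℕ → ℝ) (τ : ℝ)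
    (L Fτ : (Fin N → Polynomial ℝ) → (Fin N → Polynomial ℝ))
    (un : Fin N → Polynomial ℝ) (uh uσ : ℕ → Fin N → Polynomial ℝ) : Prop :=
  uσ 0 = un ∧ ∀ ℓ < s, uh (ℓ+1) = rkStage c d τ L uσ ℓ ∧ uσ (ℓ+1) = Fτ (uh (ℓ+1))

/-- The full OEDG evolution: `uσ n ℓ = u_σ^{n,ℓ}` and `uh n ℓ = u_h^{n,ℓ}`, starting from
`u_σ^0 = u0`, with `u_σ^{n+1} = u_σ^{n,s}`. -/
def IsOEDGEvol [NeZero N] (s : ℕ) (c d : ℕ → ℕ → ℝ) (τ : ℝ)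
    (L Fτ : (Fin N → Polynomial ℝ) → (Fin N → Polynomial ℝ))
    (u0 : Fin N → Polynomial ℝ) (uh uσ : ℕ → ℕ → Fin N → Polynomial ℝ) : Prop :=
  uσ 0 0 = u0 ∧ ∀ n, uσ (n+1) 0 = uσ n s ∧
    ∀ ℓ < s, uh n (ℓ+1) = rkStage c d τ L (uσ n) ℓ ∧ uσ n (ℓ+1) = Fτ (uh n (ℓ+1))

/-- `p` is the Gauss–Radau projection of `w` on `[a,b]` into `ℙ^k`:
`∫_a^b (w - p) q dx = 0` for all `q ∈ ℙ^{k-1}` and `p(b) = w(b)`. -/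
def IsGRProj (k : ℕ) (a b : ℝ) (w : ℝ → ℝ) (p : Polynomial ℝ) : Prop :=
  p.natDegree ≤ k ∧
  (∀ q : Polynomial ℝ, q.natDegree < k →
    (∫ x in a..b, (w x - p.eval x) * q.eval x) = 0) ∧
  p.eval b = w b

/-- `u = u(x,t)` is a smooth `1`-periodic exact solution of `u_t + β u_x = 0`. -/
def IsSmoothSolution (β : ℝ) (u : ℝ → ℝ → ℝ) : Prop :=
  ContDiff ℝ (⊤ : ℕ∞) (fun p : ℝ × ℝ => u p.1 p.2) ∧
  (∀ x t, u (x+1) t = u x t) ∧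
  (∀ x t, deriv (fun s => u x s) t + β * deriv (fun y => u y t) x = 0)

/-- Auxiliary table for the reference functions `U^{n,ℓ}`. -/
noncomputable def UrefUpTo (u : ℝ → ℝ → ℝ) (c d : ℕ → ℕ → ℝ) (β τ : ℝ) (n : ℕ) :
    ℕ → ℕ → ℝ → ℝ
  | 0 => fun _ => fun x => u x ((n:ℝ) * τ)
  | (ℓ+1) => fun i =>
      if i ≤ ℓ then UrefUpTo u c d β τ n ℓ i
      else fun x => ∑ m ∈ Finset.range (ℓ+1),
        (c ℓ m * UrefUpTo u c d β τ n ℓ m x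
          - τ * d ℓ m * β * deriv (UrefUpTo u c d β τ n ℓ m) x)

/-- Reference function `U^{n,ℓ}` (for `0 ≤ ℓ ≤ s-1`): `U^{n,0} = u(·, t^n)` and
`U^{n,ℓ+1} = ∑_{0≤m≤ℓ} (c_{ℓm} U^{n,m} - τ d_{ℓm} β ∂_x U^{n,m})`. -/
noncomputable def Uref (u : ℝ → ℝ → ℝ) (c d : ℕ → ℕ → ℝ) (β τ : ℝ) (n ℓ : ℕ) : ℝ → ℝ :=
  UrefUpTo u c d β τ n ℓ ℓ

/-- Reference function `U^{n,ℓ}` including the final stage `U^{n,s} := u(·, t^{n+1})`. -/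
noncomputable def UrefS (u : ℝ → ℝ → ℝ) (c d : ℕ → ℕ → ℝ) (β τ : ℝ) (s n ℓ : ℕ) : ℝ → ℝ :=
  if ℓ = s then fun x => u x (((n:ℝ)+1) * τ) else Uref u c d β τ n ℓ

/-- The Runge–Kutta residual `ρ^{n,s-1}`, defined so that
`U^{n,s} = ∑_{0≤m≤s-1} (c_{s-1,m} U^{n,m} - τ d_{s-1,m} β ∂_x U^{n,m}) + τ ρ^{n,s-1}`. -/
noncomputable def rkRes (u : ℝ → ℝ → ℝ) (c d : ℕ → ℕ → ℝ) (β τ : ℝ) (s n : ℕ) : ℝ → ℝ :=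
  fun x => (u x (((n:ℝ)+1) * τ) - ∑ m ∈ Finset.range s,
    (c (s-1) m * Uref u c d β τ n m x
      - τ * d (s-1) m * β * deriv (Uref u c d β τ n m) x)) / τ

/-- `L²(0,1)` norm of a function. -/
noncomputable def fl2 (f : ℝ → ℝ) : ℝ := Real.sqrt (∫ x in (0:ℝ)..1, (f x)^2)

/-- `L²(Ω)` distance between a piecewise polynomial and a function. -/
noncomputable def errL2 (pt : Fin (N+1) → ℝ) (w : Fin N → Polynomial ℝ) (f : ℝ → ℝ) : ℝ :=
  Real.sqrt (∑ j : Fin N, ∫ x in (ptL pt j)..(ptR pt j), ((w j).eval x - f x)^2)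

/-- A continuous, positive definite, 2-homogeneous function controls the coordinates. -/
lemma exists_sq_le_of_homogeneous {n : ℕ} (Φ : (Fin n → ℝ) → ℝ) (hcont : Continuous Φ)
    (hhom : ∀ (t : ℝ) a, Φ (t • a) = t ^ 2 * Φ a) (hpos : ∀ a, a ≠ 0 → 0 < Φ a) :
    ∃ K : ℝ, 0 < K ∧ ∀ a i, a i ^ 2 ≤ K * Φ a := by
  by_cases hne : (Metric.sphere (0 : Fin n → ℝ) 1).Nonempty
  · obtain ⟨a0, ha0, hmin⟩ := (isCompact_sphere (0 : Fin n → ℝ) 1).exists_isMinOn hne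
      hcont.continuousOn
    have hm : 0 < Φ a0 := hpos a0 (by
      rintro rfl
      simp at ha0)
    refine ⟨(Φ a0)⁻¹, inv_pos.mpr hm, fun a i => ?_⟩
    by_cases ha : a = 0
    · have h0 : Φ 0 = 0 := by simpa using hhom 0 0
      simp [ha, h0]
    · have hna : 0 < ‖a‖ := norm_pos_iff.mpr ha
      have h1 : Φ a0 ≤ Φ (‖a‖⁻¹ • a) := hmin (by
        simp [norm_smul, hna.ne'])
      rw [hhom, inv_pow, ← div_eq_inv_mul, le_div_iff₀ (by positivity)] at h1
      have h2 : a i ^ 2 ≤ ‖a‖ ^ 2 := by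
        rw [← sq_abs]
        have := norm_le_pi_norm a i
        rw [Real.norm_eq_abs] at this
        gcongr
      rw [← div_eq_inv_mul, le_div_iff₀ hm]
      nlinarith
  · refine ⟨1, one_pos, fun a i => ?_⟩
    exfalso
    apply hne
    refine ⟨fun _ => 1, ?_⟩
    have : Nonempty (Fin n) := ⟨i⟩
    simp

lemma continuous_polynomial_eval (p : ℝ[X]) : Continuous fun x => p.eval x := p.continuous

/-- The polynomial with prescribed coefficients. -/
noncomputable def ofCoeffs {n : ℕ} (a : Fin n → ℝ) : ℝ[X] := ∑ i : Fin n, C (a i) * X ^ (i : ℕ)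

lemma eval_ofCoeffs {n : ℕ} (a : Fin n → ℝ) (x : ℝ) :
    (ofCoeffs a).eval x = ∑ i : Fin n, a i * x ^ (i : ℕ) := by
  simp [ofCoeffs, eval_finsetSum]

lemma coeff_ofCoeffs {n : ℕ} (a : Fin n → ℝ) (i : Fin n) : (ofCoeffs a).coeff i = a i := by
  simp [ofCoeffs, coeff_X_pow, Fin.val_inj, Finset.sum_ite_eq]

lemma ofCoeffs_coeff {k : ℕ} (q : ℝ[X]) (hq : q.natDegree ≤ k) :
    ofCoeffs (fun i : Fin (k + 1) => q.coeff i) = q := by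
  conv_rhs => rw [q.as_sum_range_C_mul_X_pow' (Nat.lt_succ_of_le hq)]
  rw [ofCoeffs, Finset.sum_range]

lemma natDegree_ofCoeffs_le {k : ℕ} (a : Fin (k + 1) → ℝ) : (ofCoeffs a).natDegree ≤ k := by
  refine natDegree_sum_le_of_forall_le _ _ fun i _ => ?_
  exact (natDegree_C_mul_X_pow_le _ _).trans (Nat.le_of_lt_succ i.2)

lemma ofCoeffs_smul {n : ℕ} (t : ℝ) (a : Fin n → ℝ) : ofCoeffs (t • a) = C t * ofCoeffs a := by
  simp [ofCoeffs, Finset.mul_sum, mul_assoc]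

lemma ofCoeffs_ne_zero {n : ℕ} {a : Fin n → ℝ} (ha : a ≠ 0) : ofCoeffs a ≠ 0 := by
  intro h
  apply ha
  ext i
  rw [← coeff_ofCoeffs a i, h]
  simp

lemma continuous_integral_ofCoeffs_mul {n : ℕ} (f : (Fin n → ℝ) → ℝ → ℝ)
    (hf : Continuous fun z : (Fin n → ℝ) × ℝ => f z.1 z.2) :
    Continuous fun a : Fin n → ℝ => ∫ x in (0 : ℝ)..1, (ofCoeffs a).eval x * f a x := by
  apply intervalIntegral.continuous_parametric_intervalIntegral_of_continuous'
  simp only [Function.uncurry_def, eval_ofCoeffs]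
  fun_prop

/-- A nonzero polynomial times a nonnegative continuous weight vanishing at most at one point has
positive weighted square integral. -/
lemma integral_weighted_sq_pos {q : ℝ[X]} (hq : q ≠ 0) {a b : ℝ} (hab : a < b) (g : ℝ → ℝ)
    (hg : Continuous g) (hg0 : ∀ x ∈ Set.Icc a b, 0 ≤ g x) (hgp : ∀ x ∈ Set.Ioo a b, 0 < g x) :
    0 < ∫ x in a..b, g x * q.eval x ^ 2 := by
  have hqc := continuous_polynomial_eval q
  apply intervalIntegral.integral_pos hab (by fun_prop)
  · intro x hx
    exact mul_nonneg (hg0 x ⟨hx.1.le, hx.2⟩) (sq_nonneg _)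
  · by_contra! hcon
    apply hq
    apply q.eq_zero_of_infinite_isRoot
    refine (Set.Ioo_infinite hab).mono fun x hx => ?_
    have h1 := hcon x ⟨hx.1.le, hx.2.le⟩
    have h2 := hgp x hx
    by_contra h3
    have : 0 < q.eval x ^ 2 := by
      have : q.eval x ≠ 0 := h3
      positivity
    nlinarith [mul_pos h2 this]

lemma integral_sq_pos {q : ℝ[X]} (hq : q ≠ 0) {a b : ℝ} (hab : a < b) :
    0 < ∫ x in a..b, q.eval x * q.eval x := by
  have := integral_weighted_sq_pos hq hab (fun _ => 1) continuous_const (by simp) (by simp)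
  simpa [sq] using this

lemma exists_coeff_sq_le_integral (k : ℕ) : ∃ K : ℝ, 0 < K ∧ ∀ q : ℝ[X], q.natDegree ≤ k →
    ∀ i, q.coeff i ^ 2 ≤ K * ∫ x in (0 : ℝ)..1, q.eval x * q.eval x := by
  obtain ⟨K, hK, h⟩ := exists_sq_le_of_homogeneous
    (fun a : Fin (k + 1) → ℝ => ∫ x in (0 : ℝ)..1, (ofCoeffs a).eval x * (ofCoeffs a).eval x)
    (continuous_integral_ofCoeffs_mul _ (by simp only [eval_ofCoeffs]; fun_prop))
    (fun t a => by
      rw [← intervalIntegral.integral_const_mul]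
      congr 1
      ext x
      rw [ofCoeffs_smul]
      simp
      ring)
    (fun a ha => integral_sq_pos (ofCoeffs_ne_zero ha) one_pos)
  refine ⟨K, hK, fun q hq i => ?_⟩
  by_cases hi : i < k + 1
  · have := h (fun i => q.coeff i) ⟨i, hi⟩
    simpa only [ofCoeffs_coeff q hq] using this
  · rw [coeff_eq_zero_of_natDegree_lt (by omega)]
    have : 0 ≤ ∫ x in (0 : ℝ)..1, q.eval x * q.eval x :=
      intervalIntegral.integral_nonneg (by norm_num) fun x _ => mul_self_nonneg _
    rw [zero_pow two_ne_zero]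
    exact mul_nonneg hK.le this

/-- Unisolvence of the Gauss–Radau functionals on the unit interval. -/
lemma eq_zero_of_radau {k : ℕ} {q : ℝ[X]} (hq : q.natDegree ≤ k) (h1 : q.eval 1 = 0)
    (hmom : ∀ i < k, ∫ x in (0 : ℝ)..1, q.eval x * x ^ i = 0) : q = 0 := by
  by_contra hq0
  obtain ⟨r, hr⟩ := dvd_iff_isRoot.mpr (show q.IsRoot 1 from h1)
  have hr0 : r ≠ 0 := by
    rintro rfl
    simp [hr] at hq0
  have hdeg : q.natDegree = r.natDegree + 1 := by
    rw [hr, natDegree_mul (X_sub_C_ne_zero 1) hr0, natDegree_X_sub_C, add_comm]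
  have hz : ∫ x in (0 : ℝ)..1, q.eval x * r.eval x = 0 := by
    have hexp : ∀ x : ℝ, q.eval x * r.eval x =
        ∑ i ∈ range (r.natDegree + 1), r.coeff i * (q.eval x * x ^ i) := by
      intro x
      rw [eval_eq_sum_range (p := r), Finset.mul_sum]
      exact Finset.sum_congr rfl fun i _ => by ring
    have hqc := continuous_polynomial_eval q
    simp_rw [hexp]
    rw [intervalIntegral.integral_finsetSum
      (fun i _ => (by fun_prop : Continuous fun x : ℝ =>
        r.coeff i * (q.eval x * x ^ i)).intervalIntegrable _ _)]
    refine Finset.sum_eq_zero fun i hi => ?_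
    rw [intervalIntegral.integral_const_mul, hmom i (by
      have := Finset.mem_range.mp hi
      omega), mul_zero]
  have hp := integral_weighted_sq_pos hr0 (zero_lt_one' ℝ) (fun x => 1 - x) (by fun_prop)
    (fun x hx => by linarith [hx.2]) (fun x hx => by linarith [hx.2])
  have : ∫ x in (0 : ℝ)..1, (1 - x) * r.eval x ^ 2 =
      - ∫ x in (0 : ℝ)..1, q.eval x * r.eval x := by
    rw [← intervalIntegral.integral_neg]
    congr 1
    ext x
    rw [hr]
    simp
    ring
  rw [this, hz] at hp
  simp at hp

lemma exists_coeff_le_radau (k : ℕ) : ∃ K : ℝ, 0 < K ∧ ∀ q : ℝ[X], q.natDegree ≤ k →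
    ∀ G : ℝ, |q.eval 1| ≤ G → (∀ i < k, |∫ x in (0 : ℝ)..1, q.eval x * x ^ i| ≤ G) →
    ∀ i, |q.coeff i| ≤ K * G := by
  obtain ⟨K, hK, h⟩ := exists_sq_le_of_homogeneous
    (fun a : Fin (k + 1) → ℝ => (ofCoeffs a).eval 1 ^ 2 +
      ∑ i ∈ range k, (∫ x in (0 : ℝ)..1, (ofCoeffs a).eval x * x ^ i) ^ 2)
    (by
      refine Continuous.add (by simp only [eval_ofCoeffs]; fun_prop) ?_
      refine continuous_finsetSum _ fun i _ => Continuous.pow ?_ 2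
      exact continuous_integral_ofCoeffs_mul (fun _ x => x ^ i) (by fun_prop))
    (fun t a => by
      simp only [ofCoeffs_smul, eval_mul, eval_C, mul_assoc, intervalIntegral.integral_const_mul,
        mul_pow, mul_add, Finset.mul_sum])
    (fun a ha => by
      by_contra! hcon
      have hs : 0 ≤ ∑ i ∈ range k, (∫ x in (0 : ℝ)..1, (ofCoeffs a).eval x * x ^ i) ^ 2 :=
        Finset.sum_nonneg fun i _ => sq_nonneg _
      have hs0 : ∑ i ∈ range k, (∫ x in (0 : ℝ)..1, (ofCoeffs a).eval x * x ^ i) ^ 2 = 0 := by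
        nlinarith [sq_nonneg ((ofCoeffs a).eval 1)]
      refine ofCoeffs_ne_zero ha (eq_zero_of_radau (natDegree_ofCoeffs_le a) ?_ fun i hi => ?_)
      · nlinarith [sq_nonneg ((ofCoeffs a).eval 1)]
      · have := (Finset.sum_eq_zero_iff_of_nonneg fun i _ => sq_nonneg _).mp hs0 i
          (Finset.mem_range.mpr hi)
        exact pow_eq_zero_iff two_ne_zero |>.mp this)
  refine ⟨K * (k + 1) + 1, by positivity, fun q hq G h1 hi i => ?_⟩
  have hG : 0 ≤ G := (abs_nonneg _).trans h1
  by_cases hik : i < k + 1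
  · have h2 := h (fun i => q.coeff i) ⟨i, hik⟩
    simp only [ofCoeffs_coeff q hq] at h2
    have h3 : ∑ i ∈ range k, (∫ x in (0 : ℝ)..1, q.eval x * x ^ i) ^ 2 ≤ k * G ^ 2 := by
      calc _ ≤ ∑ i ∈ range k, G ^ 2 := Finset.sum_le_sum fun i hi' => by
            rw [← sq_abs]
            have := hi i (Finset.mem_range.mp hi')
            gcongr
        _ = k * G ^ 2 := by simp
    have h4 : q.eval 1 ^ 2 ≤ G ^ 2 := by
      rw [← sq_abs]
      gcongr
    apply abs_le_of_sq_le_sq _ (by positivity)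
    calc q.coeff i ^ 2 ≤ K * (q.eval 1 ^ 2 +
          ∑ i ∈ range k, (∫ x in (0 : ℝ)..1, q.eval x * x ^ i) ^ 2) := h2
      _ ≤ K * (G ^ 2 + k * G ^ 2) := by gcongr
      _ = (K * (k + 1)) * G ^ 2 := by ring
      _ ≤ (K * (k + 1) + 1) ^ 2 * G ^ 2 := by
        gcongr
        have : 0 ≤ K * (k + 1) := by positivity
        nlinarith
      _ = _ := by ring
  · rw [coeff_eq_zero_of_natDegree_lt (by omega), abs_zero]
    positivity

lemma pderiv_succ (m : ℕ) (p : ℝ[X]) : pderiv (m + 1) p = derivative (pderiv m p) := by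
  simp only [pderiv, Function.iterate_succ', Function.comp_apply]

@[simp] lemma pderiv_zero (p : ℝ[X]) : pderiv 0 p = p := rfl

lemma pderiv_eq_iterate (m : ℕ) (p : ℝ[X]) : pderiv m p = derivative^[m] p := rfl

lemma pderiv_sub (m : ℕ) (p q : ℝ[X]) : pderiv m (p - q) = pderiv m p - pderiv m q := by
  simp [pderiv_eq_iterate]

lemma natDegree_pderiv_le {k : ℕ} (m : ℕ) {p : ℝ[X]} (hp : p.natDegree ≤ k) :
    (pderiv m p).natDegree ≤ k := by
  rw [pderiv_eq_iterate]
  exact (natDegree_iterate_derivative p m).trans (by omega)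

lemma abs_coeff_pderiv_le {k : ℕ} {q : ℝ[X]} (hq : q.natDegree ≤ k) {B : ℝ}
    (hB : ∀ i, |q.coeff i| ≤ B) (m i : ℕ) :
    |(pderiv m q).coeff i| ≤ ((k : ℝ) + 1) ^ m * B := by
  have hB0 : 0 ≤ B := (abs_nonneg _).trans (hB 0)
  induction m generalizing i with
  | zero => simpa using hB i
  | succ m ih =>
    rw [pderiv_succ, coeff_derivative]
    by_cases hi : i + 1 ≤ k
    · rw [abs_mul, pow_succ, mul_right_comm]
      have h1 : |(i : ℝ) + 1| ≤ (k : ℝ) + 1 := by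
        rw [abs_of_nonneg (by positivity)]
        have : (i : ℝ) ≤ k := by exact_mod_cast (by omega : i ≤ k)
        linarith
      gcongr
      exact ih _
    · rw [coeff_eq_zero_of_natDegree_lt
        (lt_of_le_of_lt (natDegree_pderiv_le m hq) (by omega)), zero_mul, abs_zero]
      positivity

lemma abs_eval_le_of_coeff {k : ℕ} {q : ℝ[X]} (hq : q.natDegree ≤ k) {B : ℝ}
    (hB : ∀ i, |q.coeff i| ≤ B) {y : ℝ} (hy : y ∈ Set.Icc (0 : ℝ) 1) :
    |q.eval y| ≤ ((k : ℝ) + 1) * B := by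
  rw [eval_eq_sum_range' (Nat.lt_succ_of_le hq)]
  refine (Finset.abs_sum_le_sum_abs _ _).trans ?_
  calc _ ≤ ∑ i ∈ range (k + 1), B := Finset.sum_le_sum fun i _ => by
        rw [abs_mul, abs_of_nonneg (pow_nonneg hy.1 i)]
        exact (mul_le_of_le_one_right (abs_nonneg _) (pow_le_one₀ hy.1 hy.2)).trans (hB i)
    _ = _ := by simp

lemma abs_eval_pderiv_le {k : ℕ} {q : ℝ[X]} (hq : q.natDegree ≤ k) {B : ℝ}
    (hB : ∀ i, |q.coeff i| ≤ B) {m : ℕ} (hm : m ≤ k) {y : ℝ} (hy : y ∈ Set.Icc (0 : ℝ) 1) :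
    |(pderiv m q).eval y| ≤ ((k : ℝ) + 1) ^ (k + 1) * B := by
  have hB0 : 0 ≤ B := (abs_nonneg _).trans (hB 0)
  refine (abs_eval_le_of_coeff (natDegree_pderiv_le m hq) (abs_coeff_pderiv_le hq hB m) hy).trans ?_
  rw [pow_succ', mul_assoc]
  have : (1 : ℝ) ≤ (k : ℝ) + 1 := by linarith [(Nat.cast_nonneg k : (0 : ℝ) ≤ k)]
  gcongr

/-- Pullback of a polynomial to the unit interval. -/
noncomputable def pullback (a h : ℝ) (p : ℝ[X]) : ℝ[X] := p.comp (C h * X + C a)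

lemma eval_pullback (a h : ℝ) (p : ℝ[X]) (y : ℝ) :
    (pullback a h p).eval y = p.eval (h * y + a) := by
  simp [pullback]

lemma natDegree_pullback_le {k : ℕ} (a h : ℝ) {p : ℝ[X]} (hp : p.natDegree ≤ k) :
    (pullback a h p).natDegree ≤ k := by
  refine natDegree_comp_le.trans ?_
  have : (C h * X + C a : ℝ[X]).natDegree ≤ 1 := natDegree_linear_le
  nlinarith

lemma pderiv_pullback (a h : ℝ) (p : ℝ[X]) (m : ℕ) :
    pderiv m (pullback a h p) = C (h ^ m) * pullback a h (pderiv m p) := by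
  induction m with
  | zero => simp
  | succ m ih =>
    rw [pderiv_succ, ih, pderiv_succ]
    simp only [pullback, derivative_mul, derivative_C, derivative_comp, derivative_add,
      derivative_X, zero_mul, zero_add, mul_one, add_zero, pow_succ, map_mul]
    ring

lemma integral_pullback {a b : ℝ} (hab : a < b) (f : ℝ → ℝ) :
    (b - a) * ∫ y in (0 : ℝ)..1, f ((b - a) * y + a) = ∫ x in a..b, f x := by
  have h : b - a ≠ 0 := (sub_pos.mpr hab).ne'
  rw [intervalIntegral.integral_comp_mul_add f h]
  simp [h]

lemma exists_unit_param {a b x : ℝ} (hab : a < b) (hx : x ∈ Set.Icc a b) :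
    ∃ y ∈ Set.Icc (0 : ℝ) 1, (b - a) * y + a = x := by
  have h : 0 < b - a := sub_pos.mpr hab
  refine ⟨(x - a) / (b - a), ⟨div_nonneg (by linarith [hx.1]) h.le, ?_⟩, ?_⟩
  · rw [div_le_one h]
    linarith [hx.2]
  · field_simp
    ring

/-- Inverse inequality on an interval. -/
lemma exists_inverse_ineq (k : ℕ) : ∃ K : ℝ, 0 < K ∧ ∀ (p : ℝ[X]), p.natDegree ≤ k →
    ∀ a b : ℝ, a < b → ∀ m ≤ k, ∀ x ∈ Set.Icc a b,
    (b - a) * ((b - a) ^ m * (pderiv m p).eval x) ^ 2 ≤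
      K * ∫ x in a..b, p.eval x * p.eval x := by
  obtain ⟨K, hK, h⟩ := exists_coeff_sq_le_integral k
  refine ⟨(((k : ℝ) + 1) ^ (k + 1)) ^ 2 * K, by positivity, fun p hp a b hab m hm x hx => ?_⟩
  obtain ⟨y, hy, rfl⟩ := exists_unit_param hab hx
  have hba : 0 < b - a := sub_pos.mpr hab
  set I := ∫ y in (0 : ℝ)..1, (pullback a (b - a) p).eval y * (pullback a (b - a) p).eval y with hI
  have hI0 : 0 ≤ I := intervalIntegral.integral_nonneg (by norm_num) fun x _ => mul_self_nonneg _
  have hIe : (b - a) * I = ∫ x in a..b, p.eval x * p.eval x := by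
    rw [hI]
    simp only [eval_pullback]
    exact integral_pullback hab fun x => p.eval x * p.eval x
  have hdeg := natDegree_pullback_le a (b - a) hp
  have hc : ∀ i, |(pullback a (b - a) p).coeff i| ≤ Real.sqrt (K * I) := fun i =>
    Real.abs_le_sqrt (h _ hdeg i)
  have h2 := abs_eval_pderiv_le hdeg hc hm hy
  rw [pderiv_pullback, eval_mul, eval_C, eval_pullback] at h2
  have h3 := pow_le_pow_left₀ (abs_nonneg _) h2 2
  rw [sq_abs, mul_pow _ (Real.sqrt _), Real.sq_sqrt (by positivity)] at h3
  rw [← hIe]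
  calc _ ≤ (b - a) * ((((k : ℝ) + 1) ^ (k + 1)) ^ 2 * (K * I)) := by gcongr
    _ = _ := by ring

/-- Stability of the Gauss–Radau projection in the maximum norm, with derivatives. -/
lemma exists_radau_stability (k : ℕ) : ∃ K : ℝ, 0 < K ∧ ∀ (p : ℝ[X]) (a b : ℝ) (g : ℝ → ℝ) (G : ℝ),
    a < b → Continuous g → (∀ x ∈ Set.Icc a b, |g x| ≤ G) → IsGRProj k a b g p →
    ∀ m ≤ k, ∀ x ∈ Set.Icc a b, |(b - a) ^ m * (pderiv m p).eval x| ≤ K * G := by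
  obtain ⟨K, hK, h⟩ := exists_coeff_le_radau k
  refine ⟨((k : ℝ) + 1) ^ (k + 1) * K, by positivity, fun p a b g G hab hg hG hp m hm x hx => ?_⟩
  obtain ⟨y, hy, rfl⟩ := exists_unit_param hab hx
  have hba : 0 < b - a := sub_pos.mpr hab
  obtain ⟨hp1, hp2, hp3⟩ := hp
  have hdeg := natDegree_pullback_le a (b - a) hp1
  have hcp := continuous_polynomial_eval p
  have hmem : ∀ z ∈ Set.Icc (0 : ℝ) 1, (b - a) * z + a ∈ Set.Icc a b := fun z hz =>
    ⟨by nlinarith [hz.1], by nlinarith [hz.2]⟩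
  have hc := h _ hdeg G (by
    rw [eval_pullback, mul_one, sub_add_cancel, hp3]
    exact hG b ⟨hab.le, le_rfl⟩) (by
    intro i hi
    have h0 := hp2 (pullback (-a / (b - a)) (b - a)⁻¹ ((X : ℝ[X]) ^ i))
      (lt_of_le_of_lt (natDegree_pullback_le _ _ (natDegree_X_pow_le i)) hi)
    rw [← integral_pullback hab, mul_eq_zero] at h0
    have h1 := h0.resolve_left hba.ne'
    have h2 : ∫ y in (0 : ℝ)..1, (pullback a (b - a) p).eval y * y ^ i =
        ∫ y in (0 : ℝ)..1, g ((b - a) * y + a) * y ^ i := by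
      rw [eq_comm, ← sub_eq_zero, ← intervalIntegral.integral_sub, ← h1]
      · congr 1
        ext z
        rw [eval_pullback, eval_pullback, eval_pow, eval_X]
        have : (b - a)⁻¹ * ((b - a) * z + a) + -a / (b - a) = z := by
          field_simp
          ring
        rw [this]
        ring
      · exact (by fun_prop : Continuous fun y : ℝ =>
          g ((b - a) * y + a) * y ^ i).intervalIntegrable _ _
      · simp only [eval_pullback]
        exact (by fun_prop : Continuous fun y : ℝ =>
          p.eval ((b - a) * y + a) * y ^ i).intervalIntegrable _ _
    rw [h2]
    have h3 := intervalIntegral.norm_integral_le_of_norm_le_const (a := (0 : ℝ)) (b := 1) (C := G)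
      (f := fun y => g ((b - a) * y + a) * y ^ i) (by
        intro z hz
        rw [Set.uIoc_of_le zero_le_one] at hz
        have hz' : z ∈ Set.Icc (0 : ℝ) 1 := ⟨hz.1.le, hz.2⟩
        rw [Real.norm_eq_abs, abs_mul, abs_of_nonneg (pow_nonneg hz'.1 i)]
        exact (mul_le_of_le_one_right (abs_nonneg _) (pow_le_one₀ hz'.1 hz'.2)).trans
          (hG _ (hmem z hz')))
    simpa using h3)
  have h2 := abs_eval_pderiv_le hdeg hc hm hy
  rw [pderiv_pullback, eval_mul, eval_C, eval_pullback] at h2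
  rw [mul_assoc]
  exact h2

/-- A smooth function with vanishing derivatives up to order `k` at `x₀` is `O(|x-x₀|^{k+1})`. -/
lemma abs_le_pow_of_iteratedDeriv_eq_zero (k : ℕ) {M x₀ : ℝ} {D : ℝ → ℝ}
    (hD : ContDiff ℝ (⊤ : ℕ∞) D) (h0 : ∀ m ≤ k, iteratedDeriv m D x₀ = 0)
    (hM : ∀ x, |iteratedDeriv (k + 1) D x| ≤ M) (x : ℝ) : |D x| ≤ M * |x - x₀| ^ (k + 1) := by
  have hdiff : Differentiable ℝ D := hD.differentiable (by simp)
  have hM0 : 0 ≤ M := (abs_nonneg _).trans (hM 0)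
  have key : ∀ B : ℝ, (∀ y ∈ Set.uIcc x₀ x, |deriv D y| ≤ B) → |D x| ≤ B * |x - x₀| := by
    intro B hB
    have := (convex_uIcc x₀ x).norm_image_sub_le_of_norm_deriv_le (f := D)
      (fun y _ => hdiff y) hB Set.left_mem_uIcc Set.right_mem_uIcc
    have hz : D x₀ = 0 := by simpa using h0 0 (Nat.zero_le _)
    simpa [hz] using this
  induction k generalizing D x with
  | zero =>
    rw [zero_add, pow_one]
    exact key M fun y _ => by simpa [iteratedDeriv_one] using hM y
  | succ k ih =>
    rw [pow_succ, ← mul_assoc]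
    refine key _ fun y hy => ?_
    have hD' : ContDiff ℝ (⊤ : ℕ∞) (deriv D) := by
      have : ContDiff ℝ ((⊤ : ℕ∞) + 1) D := hD
      exact (contDiff_succ_iff_deriv.mp this).2.2
    have hdiff' : Differentiable ℝ (deriv D) := hD'.differentiable (by simp)
    have h0' : ∀ m ≤ k, iteratedDeriv m (deriv D) x₀ = 0 := fun m hm => by
      rw [← iteratedDeriv_succ']
      exact h0 (m + 1) (by omega)
    have := ih hD' h0' (fun x => by
      rw [← iteratedDeriv_succ']
      exact hM x) y hdiff' (by
        intro B hB
        have := (convex_uIcc x₀ y).norm_image_sub_le_of_norm_deriv_le (f := deriv D)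
          (fun y _ => hdiff' y) hB Set.left_mem_uIcc Set.right_mem_uIcc
        have hz : deriv D x₀ = 0 := by simpa using h0' 0 (Nat.zero_le _)
        simpa [hz] using this)
    refine this.trans ?_
    have hyx : |y - x₀| ≤ |x - x₀| := by
      rcases Set.mem_uIcc.mp hy with h | h
      · rw [abs_of_nonneg (by linarith), abs_of_nonneg (by linarith)]
        linarith
      · rw [abs_of_nonpos (by linarith), abs_of_nonpos (by linarith)]
        linarith
    gcongr

lemma iteratedDeriv_polynomial_eval (m : ℕ) (p : ℝ[X]) :
    iteratedDeriv m (fun x => p.eval x) = fun x => (pderiv m p).eval x := by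
  induction m with
  | zero => simp
  | succ m ih =>
    rw [iteratedDeriv_succ, ih, pderiv_succ]
    ext x
    simp

lemma contDiff_polynomial_eval (p : ℝ[X]) : ContDiff ℝ (⊤ : ℕ∞) fun x => p.eval x := by
  have := p.contDiff_aeval (𝕜 := ℝ) (⊤ : ℕ∞)
  simpa [Polynomial.coe_aeval_eq_eval] using this

/-- Taylor polynomials: prescribed derivatives at a point. -/
lemma exists_polynomial_pderiv_eq (k : ℕ) (x₀ : ℝ) (f : ℕ → ℝ) : ∃ T : ℝ[X], T.natDegree ≤ k ∧
    ∀ m ≤ k, (pderiv m T).eval x₀ = f m := by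
  refine ⟨taylor (-x₀) (ofCoeffs fun i : Fin (k + 1) => f i / (i : ℕ).factorial), ?_, ?_⟩
  · rw [natDegree_taylor]
    exact natDegree_ofCoeffs_le _
  · intro m hm
    rw [pderiv_eq_iterate, ← factorial_smul_hasseDeriv]
    simp only [LinearMap.smul_apply, eval_smul]
    rw [← taylor_coeff, taylor_taylor, add_neg_cancel, taylor_zero]
    have := coeff_ofCoeffs (fun i : Fin (k + 1) => f i / (i : ℕ).factorial)
      ⟨m, Nat.lt_succ_of_le hm⟩
    simp only at this
    rw [this, nsmul_eq_mul, mul_div_cancel₀]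
    exact_mod_cast Nat.factorial_ne_zero m

/-- Approximation property of the Gauss–Radau projection. -/
lemma exists_radau_approx (k : ℕ) : ∃ K : ℝ, 0 < K ∧ ∀ (p : ℝ[X]) (a b : ℝ) (W : ℝ → ℝ) (M : ℝ),
    a < b → ContDiff ℝ (⊤ : ℕ∞) W → (∀ x, |iteratedDeriv (k + 1) W x| ≤ M) →
    IsGRProj k a b W p → ∀ m ≤ k, ∀ x ∈ Set.Icc a b,
    |(b - a) ^ m * ((pderiv m p).eval x - iteratedDeriv m W x)| ≤ K * (M * (b - a) ^ (k + 1)) := by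
  obtain ⟨K, hK, h⟩ := exists_radau_stability k
  refine ⟨K, hK, fun p a b W M hab hW hM hp m hm x hx => ?_⟩
  obtain ⟨T, hT, hTd⟩ := exists_polynomial_pderiv_eq k x fun i => iteratedDeriv i W x
  have hM0 : 0 ≤ M := (abs_nonneg _).trans (hM 0)
  have hTc := contDiff_polynomial_eval T
  have hgi : ∀ i y, iteratedDeriv i (fun y => W y - T.eval y) y =
      iteratedDeriv i W y - (pderiv i T).eval y := by
    intro i y
    rw [iteratedDeriv_fun_sub (hW.contDiffAt.of_le (by exact_mod_cast le_top))
      (hTc.contDiffAt.of_le (by exact_mod_cast le_top)), iteratedDeriv_polynomial_eval]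
  have hpT : IsGRProj k a b (fun y => W y - T.eval y) (p - T) := by
    obtain ⟨h1, h2, h3⟩ := hp
    refine ⟨(natDegree_sub_le _ _).trans (max_le h1 hT), fun q hq => ?_, by simp [h3]⟩
    rw [← h2 q hq]
    congr 1
    ext y
    simp
  have hg := abs_le_pow_of_iteratedDeriv_eq_zero k (M := M) (x₀ := x) (hW.sub hTc)
    (fun i hi => by rw [hgi, hTd i hi, sub_self])
    (fun y => by
      rw [hgi, pderiv_eq_iterate, iterate_derivative_eq_zero (Nat.lt_succ_of_le hT)]
      simpa using hM y)
  have := h (p - T) a b (fun y => W y - T.eval y) (M * (b - a) ^ (k + 1)) hab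
    (hW.continuous.sub T.continuous) (fun y hy => (hg y).trans (by
      have : |y - x| ≤ b - a := by
        rw [abs_le]
        constructor <;> linarith [hx.1, hx.2, hy.1, hy.2]
      gcongr)) hpT m hm x hx
  rwa [pderiv_sub, eval_sub, hTd m hm] at this

lemma cip_comm (pt : Fin (N + 1) → ℝ) (j : Fin N) (p q : ℝ[X]) : cip pt j p q = cip pt j q p := by
  simp only [cip, mul_comm]

lemma intervalIntegrable_polynomial_mul (a b : ℝ) (p q : ℝ[X]) :
    IntervalIntegrable (fun x => p.eval x * q.eval x) volume a b :=
  (p.continuous.mul q.continuous).intervalIntegrable _ _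

lemma cip_add_left (pt : Fin (N + 1) → ℝ) (j : Fin N) (p p' q : ℝ[X]) :
    cip pt j (p + p') q = cip pt j p q + cip pt j p' q := by
  simp only [cip, eval_add, add_mul]
  exact intervalIntegral.integral_add (intervalIntegrable_polynomial_mul _ _ _ _)
    (intervalIntegrable_polynomial_mul _ _ _ _)

lemma cip_sub_left (pt : Fin (N + 1) → ℝ) (j : Fin N) (p p' q : ℝ[X]) :
    cip pt j (p - p') q = cip pt j p q - cip pt j p' q := by
  simp only [cip, eval_sub, sub_mul]
  exact intervalIntegral.integral_sub (intervalIntegrable_polynomial_mul _ _ _ _)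
    (intervalIntegrable_polynomial_mul _ _ _ _)

lemma cip_C_mul_left (pt : Fin (N + 1) → ℝ) (j : Fin N) (t : ℝ) (p q : ℝ[X]) :
    cip pt j (C t * p) q = t * cip pt j p q := by
  simp only [cip, eval_mul, eval_C, mul_assoc, intervalIntegral.integral_const_mul]

lemma cip_C_mul_right (pt : Fin (N + 1) → ℝ) (j : Fin N) (t : ℝ) (p q : ℝ[X]) :
    cip pt j p (C t * q) = t * cip pt j p q := by
  rw [cip_comm, cip_C_mul_left, cip_comm]

lemma cip_sum_left {ι : Type*} (pt : Fin (N + 1) → ℝ) (j : Fin N) (s : Finset ι) (f : ι → ℝ[X])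
    (q : ℝ[X]) : cip pt j (∑ i ∈ s, f i) q = ∑ i ∈ s, cip pt j (f i) q := by
  classical
  induction s using Finset.induction_on with
  | empty => simp [cip]
  | insert a s ha ih => rw [Finset.sum_insert ha, Finset.sum_insert ha, cip_add_left, ih]

lemma cip_sum_right {ι : Type*} (pt : Fin (N + 1) → ℝ) (j : Fin N) (s : Finset ι) (f : ι → ℝ[X])
    (q : ℝ[X]) : cip pt j q (∑ i ∈ s, f i) = ∑ i ∈ s, cip pt j q (f i) := by
  rw [cip_comm, cip_sum_left]
  exact Finset.sum_congr rfl fun i _ => cip_comm _ _ _ _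

lemma ptL_lt_ptR {pt : Fin (N + 1) → ℝ} (hpt : IsMesh pt) (j : Fin N) : ptL pt j < ptR pt j :=
  hpt.2.2 (Fin.castSucc_lt_succ)

lemma cip_self_nonneg {pt : Fin (N + 1) → ℝ} (hpt : IsMesh pt) (j : Fin N) (p : ℝ[X]) :
    0 ≤ cip pt j p p :=
  intervalIntegral.integral_nonneg (ptL_lt_ptR hpt j).le fun _ _ => mul_self_nonneg _

lemma cip_self_pos {pt : Fin (N + 1) → ℝ} (hpt : IsMesh pt) (j : Fin N) {p : ℝ[X]} (hp : p ≠ 0) :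
    0 < cip pt j p p :=
  integral_sq_pos hp (ptL_lt_ptR hpt j)

/-- The monic orthogonal polynomials of a cell, expressed through the cell projections. -/
noncomputable def orthoPoly (P : ℕ → ℝ[X] → ℝ[X]) : ℕ → ℝ[X]
  | 0 => 1
  | i + 1 => X ^ (i + 1) - P i (X ^ (i + 1))

section ortho

variable {pt : Fin (N + 1) → ℝ} {Pc : Fin N → ℕ → ℝ[X] → ℝ[X]}

lemma natDegree_orthoPoly_le (hPc : IsCellProj pt Pc) (j : Fin N) (i : ℕ) :
    (orthoPoly (Pc j) i).natDegree ≤ i := by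
  cases i with
  | zero => simp [orthoPoly]
  | succ i =>
    refine (natDegree_sub_le _ _).trans (max_le (natDegree_X_pow_le _) ?_)
    exact (hPc j i _).1.trans (Nat.le_succ i)

lemma coeff_orthoPoly (hPc : IsCellProj pt Pc) (j : Fin N) (i : ℕ) :
    (orthoPoly (Pc j) i).coeff i = 1 := by
  cases i with
  | zero => simp [orthoPoly]
  | succ i =>
    rw [orthoPoly, coeff_sub, coeff_X_pow, if_pos rfl,
      coeff_eq_zero_of_natDegree_lt (Nat.lt_succ_of_le (hPc j i _).1), sub_zero]

lemma orthoPoly_ne_zero (hPc : IsCellProj pt Pc) (j : Fin N) (i : ℕ) :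
    orthoPoly (Pc j) i ≠ 0 := by
  intro h
  have := coeff_orthoPoly hPc j i
  simp [h] at this

lemma cip_orthoPoly_of_natDegree_lt (hPc : IsCellProj pt Pc) (j : Fin N) {i : ℕ} {q : ℝ[X]}
    (hq : q.natDegree < i) : cip pt j q (orthoPoly (Pc j) i) = 0 := by
  cases i with
  | zero => omega
  | succ i =>
    rw [cip_comm]
    exact (hPc j i _).2 q (Nat.le_of_lt_succ hq)

lemma cip_orthoPoly_ne (hPc : IsCellProj pt Pc) (j : Fin N) {i i' : ℕ} (h : i ≠ i') :
    cip pt j (orthoPoly (Pc j) i) (orthoPoly (Pc j) i') = 0 := by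
  rcases lt_or_gt_of_ne h with h | h
  · exact cip_orthoPoly_of_natDegree_lt hPc j
      (lt_of_le_of_lt (natDegree_orthoPoly_le hPc j i) h)
  · rw [cip_comm]
    exact cip_orthoPoly_of_natDegree_lt hPc j
      (lt_of_le_of_lt (natDegree_orthoPoly_le hPc j i') h)

lemma exists_orthoPoly_expansion (hPc : IsCellProj pt Pc) (j : Fin N) (k : ℕ) (p : ℝ[X])
    (hp : p.natDegree ≤ k) :
    ∃ a : ℕ → ℝ, p = ∑ i ∈ range (k + 1), C (a i) * orthoPoly (Pc j) i := by
  induction k generalizing p with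
  | zero =>
    refine ⟨fun _ => p.coeff 0, ?_⟩
    simpa [orthoPoly] using eq_C_of_natDegree_le_zero hp
  | succ k ih =>
    obtain ⟨a, ha⟩ := ih (p - C (p.coeff (k + 1)) * orthoPoly (Pc j) (k + 1)) (by
      rw [natDegree_le_iff_coeff_eq_zero]
      intro n hn
      rw [coeff_sub, coeff_C_mul]
      rcases Nat.eq_or_lt_of_le (Nat.succ_le_of_lt hn) with h | h
      · rw [← h, Nat.succ_eq_add_one, coeff_orthoPoly hPc j]
        ring
      · rw [coeff_eq_zero_of_natDegree_lt (lt_of_le_of_lt hp h),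
          coeff_eq_zero_of_natDegree_lt
            (lt_of_le_of_lt (natDegree_orthoPoly_le hPc j (k + 1)) h)]
        ring)
    refine ⟨fun i => if i = k + 1 then p.coeff (k + 1) else a i, ?_⟩
    rw [Finset.sum_range_succ]
    beta_reduce
    rw [if_pos rfl]
    rw [sub_eq_iff_eq_add] at ha
    refine ha.trans ?_
    congr 1
    refine Finset.sum_congr rfl fun i hi => ?_
    rw [if_neg (Finset.mem_range.mp hi).ne]

lemma cip_expansion_orthoPoly (hPc : IsCellProj pt Pc) (j : Fin N) (k : ℕ) (a : ℕ → ℝ)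
    {i : ℕ} (hi : i ∈ range (k + 1)) :
    cip pt j (∑ i ∈ range (k + 1), C (a i) * orthoPoly (Pc j) i) (orthoPoly (Pc j) i) =
      a i * cip pt j (orthoPoly (Pc j) i) (orthoPoly (Pc j) i) := by
  rw [cip_sum_left, Finset.sum_eq_single_of_mem i hi]
  · rw [cip_C_mul_left]
  · intro i' _ hne
    rw [cip_C_mul_left, cip_orthoPoly_ne hPc j hne, mul_zero]

lemma cip_self_expansion (hPc : IsCellProj pt Pc) (j : Fin N) (k : ℕ) (a : ℕ → ℝ) :
    cip pt j (∑ i ∈ range (k + 1), C (a i) * orthoPoly (Pc j) i)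
      (∑ i ∈ range (k + 1), C (a i) * orthoPoly (Pc j) i) =
      ∑ i ∈ range (k + 1), a i ^ 2 * cip pt j (orthoPoly (Pc j) i) (orthoPoly (Pc j) i) := by
  rw [cip_sum_right]
  refine Finset.sum_congr rfl fun i hi => ?_
  rw [cip_C_mul_right, cip_expansion_orthoPoly hPc j k a hi]
  ring

/-- The damping procedure moves a cell polynomial by at most `t ∑ δ` relative to its norm. -/
lemma cip_damping_sub_le [NeZero N] {k : ℕ} {β : Fin N → ℝ} {u : Fin N → ℝ[X]}
    {w : ℝ → Fin N → ℝ[X]} (hpt : IsMesh pt) (hPc : IsCellProj pt Pc)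
    (hw : IsDampingSol k pt β Pc u w) (j : Fin N) (hδ : ∀ m, 0 ≤ dampRate k pt β u m j)
    {t : ℝ} (ht : 0 ≤ t) :
    cip pt j (w t j - u j) (w t j - u j) ≤
      (t * ∑ m ∈ range (k + 1), dampRate k pt β u m j) ^ 2 * cip pt j (u j) (u j) := by
  obtain ⟨hw0, hwd, hwt⟩ := hw
  set Λ := ∑ m ∈ range (k + 1), dampRate k pt β u m j with hΛ
  set φ := orthoPoly (Pc j) with hφ
  set lam : ℕ → ℝ := fun i => ∑ m ∈ range (k + 1),
    if m - 1 < i then dampRate k pt β u m j else 0 with hlam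
  have hlam0 : ∀ i, 0 ≤ lam i := fun i => Finset.sum_nonneg fun m _ => by
    split_ifs
    exacts [hδ m, le_rfl]
  have hlamΛ : ∀ i, lam i ≤ Λ := fun i => Finset.sum_le_sum fun m _ => by
    split_ifs
    exacts [le_rfl, hδ m]
  have hode : ∀ i ∈ range (k + 1), ∀ s, HasDerivAt (fun s => cip pt j (w s j) (φ i))
      (-(lam i) * cip pt j (w s j) (φ i)) s := by
    intro i hi s
    have h := hwt s j (φ i) ((natDegree_orthoPoly_le hPc j i).trans
      (Nat.le_of_lt_succ (Finset.mem_range.mp hi)))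
    convert h using 1
    rw [neg_mul, hlam, Finset.sum_mul]
    congr 1
    refine Finset.sum_congr rfl fun m _ => ?_
    split_ifs with hmi
    · rw [cip_sub_left, cip_orthoPoly_of_natDegree_lt hPc j
        (lt_of_le_of_lt (hPc j (m - 1) (w s j)).1 hmi), sub_zero]
    · rw [(hPc j (m - 1) (w s j)).2 (φ i)
        ((natDegree_orthoPoly_le hPc j i).trans (by omega))]
      simp
  have hsol : ∀ i ∈ range (k + 1),
      cip pt j (w t j) (φ i) = Real.exp (-(lam i * t)) * cip pt j (u j) (φ i) := by
    intro i hi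
    have hd : ∀ s, HasDerivAt (fun s => Real.exp (lam i * s) * cip pt j (w s j) (φ i)) 0 s := by
      intro s
      have h1 : HasDerivAt (fun s => Real.exp (lam i * s)) (Real.exp (lam i * s) * lam i) s := by
        simpa using ((hasDerivAt_id s).const_mul (lam i)).exp
      have h2 := h1.fun_mul (hode i hi s)
      rwa [show Real.exp (lam i * s) * lam i * cip pt j (w s j) (φ i) +
        Real.exp (lam i * s) * (-lam i * cip pt j (w s j) (φ i)) = 0 by ring] at h2
    have hc := is_const_of_deriv_eq_zero (fun s => (hd s).differentiableAt)
      (fun s => (hd s).deriv) t 0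
    simp only [mul_zero, Real.exp_zero, one_mul, hw0] at hc
    rw [← hc, ← mul_assoc, ← Real.exp_add]
    simp
  obtain ⟨a, ha⟩ := exists_orthoPoly_expansion hPc j k (w t j) (hwd t j)
  obtain ⟨b, hb⟩ := exists_orthoPoly_expansion hPc j k (u j) (by
    rw [← hw0]
    exact hwd 0 j)
  have hab : ∀ i ∈ range (k + 1), a i = Real.exp (-(lam i * t)) * b i := by
    intro i hi
    have h := hsol i hi
    rw [ha, hb, cip_expansion_orthoPoly hPc j k a hi, cip_expansion_orthoPoly hPc j k b hi,
      ← mul_assoc] at h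
    exact mul_right_cancel₀ (cip_self_pos hpt j (orthoPoly_ne_zero hPc j i)).ne' h
  have hsub : w t j - u j = ∑ i ∈ range (k + 1), C (a i - b i) * φ i := by
    rw [ha, hb, ← Finset.sum_sub_distrib]
    exact Finset.sum_congr rfl fun i _ => by rw [C_sub, sub_mul]
  rw [hsub, cip_self_expansion hPc, hb, cip_self_expansion hPc, Finset.mul_sum]
  refine Finset.sum_le_sum fun i hi => ?_
  rw [← mul_assoc]
  refine mul_le_mul_of_nonneg_right ?_ (cip_self_nonneg hpt j _)
  rw [hab i hi, ← mul_pow]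
  have h1 : Real.exp (-(lam i * t)) * b i - b i = -((1 - Real.exp (-(lam i * t))) * b i) := by ring
  rw [h1, neg_sq, mul_pow, mul_pow]
  refine mul_le_mul_of_nonneg_right ?_ (sq_nonneg _)
  have h2 : 0 ≤ lam i * t := mul_nonneg (hlam0 i) ht
  have h3 : Real.exp (-(lam i * t)) ≤ 1 := Real.exp_le_one_iff.mpr (by linarith)
  have h4 := Real.add_one_le_exp (-(lam i * t))
  have h5 : lam i * t ≤ t * Λ := by
    rw [mul_comm]
    exact mul_le_mul_of_nonneg_left (hlamΛ i) ht
  exact pow_le_pow_left₀ (by linarith) (by linarith) 2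

end ortho

lemma contDiff_deriv_of_contDiff {f : ℝ → ℝ} (hf : ContDiff ℝ (⊤ : ℕ∞) f) :
    ContDiff ℝ (⊤ : ℕ∞) (deriv f) := by
  have : ContDiff ℝ ((⊤ : ℕ∞) + 1) f := hf
  exact (contDiff_succ_iff_deriv.mp this).2.2

lemma contDiff_iteratedDeriv {f : ℝ → ℝ} (hf : ContDiff ℝ (⊤ : ℕ∞) f) (i : ℕ) :
    ContDiff ℝ (⊤ : ℕ∞) (iteratedDeriv i f) := by
  induction i with
  | zero => simpa using hf
  | succ i ih =>
    rw [iteratedDeriv_succ]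
    exact contDiff_deriv_of_contDiff ih

lemma deriv_periodic {f : ℝ → ℝ} (hf : ∀ x, f (x + 1) = f x) (x : ℝ) :
    deriv f (x + 1) = deriv f x := by
  rw [← deriv_comp_add_const]
  congr 1
  ext y
  exact hf y

lemma iteratedDeriv_periodic {f : ℝ → ℝ} (hf : ∀ x, f (x + 1) = f x) (i : ℕ) (x : ℝ) :
    iteratedDeriv i f (x + 1) = iteratedDeriv i f x := by
  induction i generalizing x with
  | zero => simpa using hf x
  | succ i ih =>
    rw [iteratedDeriv_succ]
    exact deriv_periodic ih x

lemma exists_bound_of_periodic {f : ℝ → ℝ} (hc : Continuous f) (hf : ∀ x, f (x + 1) = f x) :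
    ∃ M : ℝ, ∀ x, |f x| ≤ M := by
  obtain ⟨M, hM⟩ := isCompact_Icc.exists_bound_of_continuousOn
    (s := Set.Icc (0 : ℝ) 1) hc.continuousOn
  refine ⟨M, fun x => ?_⟩
  obtain ⟨y, hy, hxy⟩ := Function.Periodic.exists_mem_Ico₀ (f := f) (c := 1) hf one_pos x
  rw [hxy]
  exact hM y ⟨hy.1, hy.2.le⟩

lemma IsSmoothSolution.eq_shift {β : ℝ} {u : ℝ → ℝ → ℝ} (hu : IsSmoothSolution β u) (x t : ℝ) :
    u x t = u (x - β * t) 0 := by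
  obtain ⟨hs, -, heq⟩ := hu
  set F : ℝ × ℝ → ℝ := fun p => u p.1 p.2 with hF
  have hFd : Differentiable ℝ F := hs.differentiable (by simp)
  have hx : ∀ x t, HasDerivAt (fun y => u y t) (fderiv ℝ F (x, t) (1, 0)) x := fun x t => by
    have h1 : HasDerivAt (fun y : ℝ => (y, t)) ((1 : ℝ), (0 : ℝ)) x :=
      (hasDerivAt_id x).prodMk (hasDerivAt_const x t)
    exact (hFd (x, t)).hasFDerivAt.comp_hasDerivAt x h1
  have ht : ∀ x t, HasDerivAt (fun s => u x s) (fderiv ℝ F (x, t) (0, 1)) t := fun x t => by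
    have h1 : HasDerivAt (fun s : ℝ => (x, s)) ((0 : ℝ), (1 : ℝ)) t :=
      (hasDerivAt_const t x).prodMk (hasDerivAt_id t)
    exact (hFd (x, t)).hasFDerivAt.comp_hasDerivAt t h1
  have hg : ∀ s, HasDerivAt (fun s => u (x - β * t + β * s) s) 0 s := fun s => by
    have h0 : HasDerivAt (fun s : ℝ => x - β * t + β * s) β s := by
      simpa using ((hasDerivAt_id s).const_mul β).const_add (x - β * t)
    have h1 : HasDerivAt (fun s : ℝ => (x - β * t + β * s, s)) (β, (1 : ℝ)) s :=
      h0.prodMk (hasDerivAt_id s)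
    have h2 : HasDerivAt (fun s => u (x - β * t + β * s) s)
        (fderiv ℝ F (x - β * t + β * s, s) (β, 1)) s :=
      HasFDerivAt.comp_hasDerivAt (f := fun s : ℝ => (x - β * t + β * s, s)) s
        (hFd (x - β * t + β * s, s)).hasFDerivAt h1
    have h3 := heq (x - β * t + β * s) s
    rw [(hx _ _).deriv, (ht _ _).deriv] at h3
    have h4 : ((β, 1) : ℝ × ℝ) = (0, 1) + β • (1, 0) := by simp
    rw [h4, map_add, map_smul, smul_eq_mul, h3] at h2
    exact h2
  have := is_const_of_deriv_eq_zero (fun s => (hg s).differentiableAt) (fun s => (hg s).deriv) t 0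
  simpa using this

/-- A family of smooth periodic functions all of whose derivatives are bounded uniformly in the
time step `τ ∈ (0,1]` and the time level. -/
structure UniformlySmooth (G : ℝ → ℕ → ℝ → ℝ) : Prop where
  smooth : ∀ τ n, ContDiff ℝ (⊤ : ℕ∞) (G τ n)
  periodic : ∀ τ n x, G τ n (x + 1) = G τ n x
  bounded : ∀ i, ∃ M : ℝ, ∀ τ, 0 < τ → τ ≤ 1 → ∀ n x, |iteratedDeriv i (G τ n) x| ≤ M

lemma UniformlySmooth.zero : UniformlySmooth fun _ _ _ => 0 where
  smooth _ _ := contDiff_const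
  periodic _ _ _ := rfl
  bounded i := ⟨0, fun τ _ _ n x => by simp⟩

lemma UniformlySmooth.add {G H : ℝ → ℕ → ℝ → ℝ} (hG : UniformlySmooth G) (hH : UniformlySmooth H) :
    UniformlySmooth fun τ n x => G τ n x + H τ n x where
  smooth τ n := (hG.smooth τ n).add (hH.smooth τ n)
  periodic τ n x := by rw [hG.periodic, hH.periodic]
  bounded i := by
    obtain ⟨M, hM⟩ := hG.bounded i
    obtain ⟨M', hM'⟩ := hH.bounded i
    refine ⟨M + M', fun τ h0 h1 n x => ?_⟩
    rw [iteratedDeriv_fun_add ((hG.smooth τ n).contDiffAt.of_le (by exact_mod_cast le_top))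
      ((hH.smooth τ n).contDiffAt.of_le (by exact_mod_cast le_top))]
    exact (abs_add_le _ _).trans (add_le_add (hM τ h0 h1 n x) (hM' τ h0 h1 n x))

lemma UniformlySmooth.scale {G : ℝ → ℕ → ℝ → ℝ} (hG : UniformlySmooth G) (a : ℝ → ℝ) {A : ℝ}
    (hA : ∀ τ, 0 < τ → τ ≤ 1 → |a τ| ≤ A) : UniformlySmooth fun τ n x => a τ * G τ n x where
  smooth τ n := contDiff_const.mul (hG.smooth τ n)
  periodic τ n x := by rw [hG.periodic]
  bounded i := by
    obtain ⟨M, hM⟩ := hG.bounded i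
    refine ⟨A * M, fun τ h0 h1 n x => ?_⟩
    rw [iteratedDeriv_const_mul_field, abs_mul]
    have := hA τ h0 h1
    exact mul_le_mul this (hM τ h0 h1 n x) (abs_nonneg _) ((abs_nonneg _).trans this)

lemma UniformlySmooth.deriv {G : ℝ → ℕ → ℝ → ℝ} (hG : UniformlySmooth G) :
    UniformlySmooth fun τ n => _root_.deriv (G τ n) where
  smooth τ n := contDiff_deriv_of_contDiff (hG.smooth τ n)
  periodic τ n x := deriv_periodic (hG.periodic τ n) x
  bounded i := by
    obtain ⟨M, hM⟩ := hG.bounded (i + 1)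
    refine ⟨M, fun τ h0 h1 n x => ?_⟩
    rw [← iteratedDeriv_succ']
    exact hM τ h0 h1 n x

lemma UniformlySmooth.sum {G : ℕ → ℝ → ℕ → ℝ → ℝ} (s : Finset ℕ)
    (hG : ∀ m ∈ s, UniformlySmooth (G m)) :
    UniformlySmooth fun τ n x => ∑ m ∈ s, G m τ n x := by
  induction s using Finset.induction_on with
  | empty => simpa using UniformlySmooth.zero
  | insert a s ha ih =>
    simp only [Finset.sum_insert ha]
    exact (hG a (Finset.mem_insert_self a s)).add
      (ih fun m hm => hG m (Finset.mem_insert_of_mem hm))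

lemma UniformlySmooth.rkCombination {G : ℕ → ℝ → ℕ → ℝ → ℝ} (c d : ℕ → ℝ) (β : ℝ) (L : ℕ)
    (hG : ∀ m, UniformlySmooth (G m)) :
    UniformlySmooth fun τ n x => ∑ m ∈ range L,
      (c m * G m τ n x - τ * d m * β * _root_.deriv (G m τ n) x) := by
  refine UniformlySmooth.sum (G := fun m τ n x =>
    c m * G m τ n x - τ * d m * β * _root_.deriv (G m τ n) x) _ fun m _ => ?_
  have h1 := (hG m).scale (fun _ => c m) (A := |c m|) fun _ _ _ => le_rfl
  have h2 := (hG m).deriv.scale (fun τ => -(τ * d m * β)) (A := |d m * β|) fun τ h0 h1 => by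
    rw [abs_neg, mul_assoc, abs_mul, abs_of_pos h0]
    exact mul_le_of_le_one_left (abs_nonneg _) h1
  simpa [sub_eq_add_neg, neg_mul] using h1.add h2

lemma UniformlySmooth.solution {β : ℝ} {u : ℝ → ℝ → ℝ} (hu : IsSmoothSolution β u)
    (t : ℝ → ℕ → ℝ) : UniformlySmooth fun τ n x => u x (t τ n) := by
  have h0 : ContDiff ℝ (⊤ : ℕ∞) fun x => u x 0 :=
    hu.1.comp (contDiff_id.prodMk contDiff_const)
  refine ⟨fun τ n => hu.1.comp (contDiff_id.prodMk contDiff_const), fun τ n x => hu.2.1 x _,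
    fun i => ?_⟩
  obtain ⟨M, hM⟩ := exists_bound_of_periodic (contDiff_iteratedDeriv h0 i).continuous
    (iteratedDeriv_periodic (fun x => hu.2.1 x 0) i)
  refine ⟨M, fun τ _ _ n x => ?_⟩
  have : (fun x => u x (t τ n)) = fun x => (fun y => u y 0) (x - β * t τ n) := by
    ext x
    exact hu.eq_shift x _
  rw [this, iteratedDeriv_comp_sub_const i (fun y => u y 0)]
  exact hM _

lemma UniformlySmooth.urefUpTo {β : ℝ} {u : ℝ → ℝ → ℝ} (hu : IsSmoothSolution β u)
    (c d : ℕ → ℕ → ℝ) (ℓ i : ℕ) : UniformlySmooth fun τ n => UrefUpTo u c d β τ n ℓ i := by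
  induction ℓ generalizing i with
  | zero => exact UniformlySmooth.solution hu fun τ n => n * τ
  | succ ℓ ih =>
    by_cases hi : i ≤ ℓ
    · simpa only [UrefUpTo, if_pos hi] using ih i
    · simp only [UrefUpTo, if_neg hi]
      exact UniformlySmooth.rkCombination (G := fun m τ n => UrefUpTo u c d β τ n ℓ m)
        (c ℓ) (d ℓ) β (ℓ + 1) ih

lemma UniformlySmooth.urefS {β : ℝ} {u : ℝ → ℝ → ℝ} (hu : IsSmoothSolution β u)
    (c d : ℕ → ℕ → ℝ) (s ℓ : ℕ) : UniformlySmooth fun τ n => UrefS u c d β τ s n ℓ := by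
  by_cases h : ℓ = s
  · simp only [UrefS, if_pos h]
    exact UniformlySmooth.solution hu fun τ n => ((n : ℝ) + 1) * τ
  · simp only [UrefS, if_neg h, Uref]
    exact UniformlySmooth.urefUpTo hu c d ℓ ℓ

/-- The derivatives of all reference functions are bounded by one constant. -/
lemma exists_uref_bound {β : ℝ} {u : ℝ → ℝ → ℝ} (hu : IsSmoothSolution β u)
    (c d : ℕ → ℕ → ℝ) (s i : ℕ) : ∃ M : ℝ, 0 < M ∧ ∀ ℓ ≤ s, ∀ τ, 0 < τ → τ ≤ 1 → ∀ n x,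
      |iteratedDeriv i (UrefS u c d β τ s n ℓ) x| ≤ M := by
  choose M hM using fun ℓ => (UniformlySmooth.urefS hu c d s ℓ).bounded i
  refine ⟨1 + ∑ ℓ ∈ range (s + 1), |M ℓ|, by positivity, fun ℓ hℓ τ h0 h1 n x => ?_⟩
  have h2 := Finset.single_le_sum (f := fun ℓ => |M ℓ|) (s := range (s + 1))
    (fun _ _ => abs_nonneg _) (Finset.mem_range.mpr (Nat.lt_succ_of_le hℓ))
  have h3 := hM ℓ τ h0 h1 n x
  have h4 := le_abs_self (M ℓ)
  linarith

lemma urefUpTo_eq_uref (u : ℝ → ℝ → ℝ) (c d : ℕ → ℕ → ℝ) (β τ : ℝ) (n : ℕ) {ℓ m : ℕ}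
    (h : m ≤ ℓ) : UrefUpTo u c d β τ n ℓ m = Uref u c d β τ n m := by
  induction ℓ with
  | zero =>
    obtain rfl : m = 0 := by omega
    rfl
  | succ ℓ ih =>
    rcases Nat.eq_or_lt_of_le h with rfl | h
    · rfl
    · simp only [UrefUpTo, if_pos (Nat.le_of_lt_succ h), ih (Nat.le_of_lt_succ h)]

/-- The recursion satisfied by the reference functions. -/
lemma urefS_succ (u : ℝ → ℝ → ℝ) (c d : ℕ → ℕ → ℝ) (β : ℝ) {τ : ℝ} (hτ : τ ≠ 0) (n : ℕ) {s ℓ : ℕ}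
    (h : ℓ < s) (x : ℝ) : UrefS u c d β τ s n (ℓ + 1) x =
      ∑ m ∈ range (ℓ + 1), (c ℓ m * UrefS u c d β τ s n m x
        - τ * d ℓ m * β * deriv (UrefS u c d β τ s n m) x)
      + if ℓ + 1 = s then τ * rkRes u c d β τ s n x else 0 := by
  have hU : ∀ m ∈ range (ℓ + 1), UrefS u c d β τ s n m = Uref u c d β τ n m := fun m hm => by
    rw [UrefS, if_neg (by have := Finset.mem_range.mp hm; omega)]
  have hsum : ∑ m ∈ range (ℓ + 1), (c ℓ m * UrefS u c d β τ s n m x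
        - τ * d ℓ m * β * deriv (UrefS u c d β τ s n m) x) =
      ∑ m ∈ range (ℓ + 1), (c ℓ m * Uref u c d β τ n m x
        - τ * d ℓ m * β * deriv (Uref u c d β τ n m) x) :=
    Finset.sum_congr rfl fun m hm => by rw [hU m hm]
  rw [hsum]
  by_cases hs : ℓ + 1 = s
  · subst hs
    simp only [UrefS, if_true, rkRes, Nat.add_sub_cancel]
    rw [mul_div_cancel₀ _ hτ]
    ring
  · rw [if_neg hs, add_zero, UrefS, if_neg hs, Uref]
    simp only [UrefUpTo, if_neg (Nat.not_succ_le_self ℓ)]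
    refine Finset.sum_congr rfl fun m hm => ?_
    rw [urefUpTo_eq_uref u c d β τ n (Nat.le_of_lt_succ (Finset.mem_range.mp hm))]

lemma continuous_rkRes {β : ℝ} {u : ℝ → ℝ → ℝ} (hu : IsSmoothSolution β u)
    (c d : ℕ → ℕ → ℝ) (τ : ℝ) (s n : ℕ) : Continuous (rkRes u c d β τ s n) := by
  have h1 := ((UniformlySmooth.solution hu fun τ n => ((n : ℝ) + 1) * τ).smooth τ n).continuous
  have h2 := ((UniformlySmooth.rkCombination (G := fun m τ n => Uref u c d β τ n m)
    (c (s - 1)) (d (s - 1)) β s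
    fun m => UniformlySmooth.urefUpTo hu c d m m).smooth τ n).continuous
  exact (h1.sub h2).div_const τ

section mesh

variable {pt : Fin (N + 1) → ℝ}

lemma cellh_pos (hpt : IsMesh pt) (j : Fin N) : 0 < cellh pt j := sub_pos.mpr (ptL_lt_ptR hpt j)

lemma cellh_le_meshSize (pt : Fin (N + 1) → ℝ) (j : Fin N) : cellh pt j ≤ meshSize pt :=
  le_ciSup (Set.finite_range _).bddAbove j

lemma meshSize_pos [NeZero N] (hpt : IsMesh pt) : 0 < meshSize pt :=
  (cellh_pos hpt 0).trans_le (cellh_le_meshSize pt 0)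

lemma sum_cell_integral (hpt : IsMesh pt) {f : ℝ → ℝ} (hf : Continuous f) :
    ∑ j : Fin N, ∫ x in (ptL pt j)..(ptR pt j), f x = ∫ x in (0 : ℝ)..1, f x := by
  set a : ℕ → ℝ := fun i => if h : i < N + 1 then pt ⟨i, h⟩ else 0 with ha
  have h := intervalIntegral.sum_integral_adjacent_intervals (μ := volume) (f := f) (a := a)
    (n := N) fun k _ => hf.intervalIntegrable _ _
  have h0 : a 0 = 0 := by
    simp only [ha, Nat.succ_pos', dif_pos]
    exact hpt.1
  have h1 : a N = 1 := by
    simp only [ha, Nat.lt_succ_self, dif_pos]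
    exact hpt.2.1
  rw [h0, h1] at h
  rw [← h, Finset.sum_range]
  refine Finset.sum_congr rfl fun j _ => ?_
  have hl : a j = ptL pt j := by
    simp only [ha, dif_pos (Nat.lt_succ_of_lt j.2)]
    rfl
  have hr : a (j + 1) = ptR pt j := by
    simp only [ha, dif_pos (Nat.succ_lt_succ j.2)]
    rfl
  rw [hl, hr]

lemma sum_cellh (hpt : IsMesh pt) : ∑ j : Fin N, cellh pt j = 1 := by
  have := sum_cell_integral hpt (f := fun _ => 1) continuous_const
  simpa [cellh] using this

lemma periodic_interface [NeZero N] (hpt : IsMesh pt) {g : ℝ → ℝ} (hg : ∀ x, g (x + 1) = g x)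
    (j : Fin N) : g (ptL pt (j + 1)) = g (ptR pt j) := by
  obtain ⟨n, rfl⟩ : ∃ n, N = n + 1 := ⟨N - 1, by have := NeZero.pos N; omega⟩
  by_cases hj : j = Fin.last n
  · subst hj
    rw [Fin.last_add_one, ptL, ptR, Fin.succ_last, hpt.2.1, Fin.castSucc_zero, hpt.1]
    simpa using (hg 0).symm
  · have : (j + 1).castSucc = j.succ := by
      ext
      rw [Fin.val_castSucc, Fin.val_add_one_of_lt (Fin.lt_last_iff_ne_last.mpr hj), Fin.val_succ]
    rw [ptL, ptR, this]

end mesh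

lemma integral_mul_sq_le {a b : ℝ} (hab : a ≤ b) {f g : ℝ → ℝ} (hf : Continuous f)
    (hg : Continuous g) : (∫ x in a..b, f x * g x) ^ 2 ≤
      (∫ x in a..b, f x ^ 2) * ∫ x in a..b, g x ^ 2 := by
  have key : ∀ t : ℝ, 0 ≤ (∫ x in a..b, g x ^ 2) * (t * t) + (2 * ∫ x in a..b, f x * g x) * t +
      ∫ x in a..b, f x ^ 2 := by
    intro t
    have h1 : 0 ≤ ∫ x in a..b, (f x + t * g x) ^ 2 :=
      intervalIntegral.integral_nonneg hab fun x _ => sq_nonneg _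
    have h2 : ∫ x in a..b, (f x + t * g x) ^ 2 =
        ∫ x in a..b, (f x ^ 2 + ((2 * t) * (f x * g x) + (t * t) * g x ^ 2)) := by
      congr 1
      ext x
      ring
    rw [h2, intervalIntegral.integral_add ((by fun_prop : Continuous _).intervalIntegrable _ _)
      ((by fun_prop : Continuous _).intervalIntegrable _ _),
      intervalIntegral.integral_add ((by fun_prop : Continuous _).intervalIntegrable _ _)
      ((by fun_prop : Continuous _).intervalIntegrable _ _),
      intervalIntegral.integral_const_mul, intervalIntegral.integral_const_mul] at h1
    linarith
  have := discrim_le_zero key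
  rw [discrim] at this
  nlinarith

lemma integral_sq_le_of_abs_le {a b B : ℝ} (hab : a ≤ b) {f : ℝ → ℝ}
    (hB : ∀ x ∈ Set.Icc a b, |f x| ≤ B) : ∫ x in a..b, f x ^ 2 ≤ (b - a) * B ^ 2 := by
  have h := intervalIntegral.norm_integral_le_of_norm_le_const (a := a) (b := b) (C := B ^ 2)
    (f := fun x => f x ^ 2) (by
      intro x hx
      rw [Set.uIoc_of_le hab] at hx
      rw [Real.norm_eq_abs, abs_pow]
      exact pow_le_pow_left₀ (abs_nonneg _) (hB x ⟨hx.1.le, hx.2⟩) 2)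
  rw [abs_of_nonneg (sub_nonneg.mpr hab), mul_comm] at h
  exact (le_abs_self _).trans h

lemma cip_self_eq (pt : Fin (N + 1) → ℝ) (j : Fin N) (p : ℝ[X]) :
    cip pt j p p = ∫ x in (ptL pt j)..(ptR pt j), p.eval x ^ 2 := by
  simp only [cip, sq]

lemma cip_sq_le {pt : Fin (N + 1) → ℝ} (hpt : IsMesh pt) (j : Fin N) (p q : ℝ[X]) :
    cip pt j p q ^ 2 ≤ cip pt j p p * cip pt j q q := by
  rw [cip_self_eq, cip_self_eq]
  exact integral_mul_sq_le (ptL_lt_ptR hpt j).le p.continuous q.continuous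

lemma cip_add_self_le {pt : Fin (N + 1) → ℝ} (hpt : IsMesh pt) (j : Fin N) (p q : ℝ[X]) :
    cip pt j (p + q) (p + q) ≤ 2 * cip pt j p p + 2 * cip pt j q q := by
  have h := cip_self_nonneg hpt j (p - q)
  rw [cip_sub_left, cip_comm, cip_sub_left, cip_comm pt j q (p - q), cip_sub_left] at h
  rw [cip_add_left, cip_comm, cip_add_left, cip_comm pt j q (p + q), cip_add_left]
  linarith

lemma cip_self_le_of_abs_le {pt : Fin (N + 1) → ℝ} (hpt : IsMesh pt) (j : Fin N) {p : ℝ[X]} {B : ℝ}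
    (hB : ∀ x ∈ Set.Icc (ptL pt j) (ptR pt j), |p.eval x| ≤ B) :
    cip pt j p p ≤ meshSize pt * B ^ 2 := by
  rw [cip_self_eq]
  exact (integral_sq_le_of_abs_le (ptL_lt_ptR hpt j).le hB).trans
    (mul_le_mul_of_nonneg_right (cellh_le_meshSize pt j) (sq_nonneg _))

/-- Inverse inequalities on a quasi-uniform mesh. -/
lemma exists_mesh_inverse (k : ℕ) {γ : ℝ} (hγ : 1 ≤ γ) : ∃ K : ℝ, 0 < K ∧
    ∀ (N : ℕ) [NeZero N] (pt : Fin (N + 1) → ℝ), IsMesh pt → QuasiUniform pt γ →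
    ∀ (j : Fin N) (p : ℝ[X]), p.natDegree ≤ k → ∀ m ≤ k, ∀ x ∈ Set.Icc (ptL pt j) (ptR pt j),
    meshSize pt * (meshSize pt ^ m * (pderiv m p).eval x) ^ 2 ≤ K * cip pt j p p := by
  obtain ⟨K, hK, h⟩ := exists_inverse_ineq k
  refine ⟨γ ^ (2 * k + 1) * K, by positivity, fun N _ pt hpt hq j p hp m hm x hx => ?_⟩
  have h1 := h p hp _ _ (ptL_lt_ptR hpt j) m hm x hx
  have hh := meshSize_pos hpt
  have hj := cellh_pos hpt j
  have hγ0 : 0 < γ := by linarith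
  have e1 : meshSize pt * (meshSize pt ^ m * (pderiv m p).eval x) ^ 2 =
      meshSize pt ^ (2 * m + 1) * (pderiv m p).eval x ^ 2 := by ring
  have e2 : (ptR pt j - ptL pt j) * ((ptR pt j - ptL pt j) ^ m * (pderiv m p).eval x) ^ 2 =
      cellh pt j ^ (2 * m + 1) * (pderiv m p).eval x ^ 2 := by
    rw [cellh]
    ring
  rw [e2] at h1
  rw [e1]
  calc meshSize pt ^ (2 * m + 1) * (pderiv m p).eval x ^ 2
      ≤ (γ * cellh pt j) ^ (2 * m + 1) * (pderiv m p).eval x ^ 2 := by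
        have := hq j
        gcongr
    _ = γ ^ (2 * m + 1) * (cellh pt j ^ (2 * m + 1) * (pderiv m p).eval x ^ 2) := by ring
    _ ≤ γ ^ (2 * k + 1) * (K * cip pt j p p) := by
        exact mul_le_mul (pow_le_pow_right₀ hγ (by omega)) h1 (by positivity) (by positivity)
    _ = _ := by ring

/-- Approximation by the Gauss–Radau projection on a quasi-uniform mesh. -/
lemma exists_mesh_radau (k : ℕ) {γ M : ℝ} (hγ : 1 ≤ γ) (hM : 0 < M) : ∃ K : ℝ, 0 < K ∧
    ∀ (N : ℕ) [NeZero N] (pt : Fin (N + 1) → ℝ), IsMesh pt → QuasiUniform pt γ →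
    ∀ (W : ℝ → ℝ), ContDiff ℝ (⊤ : ℕ∞) W → (∀ x, |iteratedDeriv (k + 1) W x| ≤ M) →
    ∀ (j : Fin N) (p : ℝ[X]), IsGRProj k (ptL pt j) (ptR pt j) W p → ∀ m ≤ k,
    ∀ x ∈ Set.Icc (ptL pt j) (ptR pt j),
    |meshSize pt ^ m * ((pderiv m p).eval x - iteratedDeriv m W x)| ≤
      K * meshSize pt ^ (k + 1) := by
  obtain ⟨K, hK, h⟩ := exists_radau_approx k
  refine ⟨γ ^ k * (K * M), by positivity,
    fun N _ pt hpt hq W hW hWM j p hp m hm x hx => ?_⟩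
  have h1 := h p _ _ W M (ptL_lt_ptR hpt j) hW hWM hp m hm x hx
  have hh := meshSize_pos hpt
  have hj := cellh_pos hpt j
  change |cellh pt j ^ m * _| ≤ K * (M * cellh pt j ^ (k + 1)) at h1
  rw [abs_mul, abs_of_pos (by positivity)] at h1 ⊢
  have hγ0 : 0 < γ := by linarith
  calc meshSize pt ^ m * |(pderiv m p).eval x - iteratedDeriv m W x|
      ≤ (γ * cellh pt j) ^ m * |(pderiv m p).eval x - iteratedDeriv m W x| := by
        have := hq j
        gcongr
    _ = γ ^ m * (cellh pt j ^ m * |(pderiv m p).eval x - iteratedDeriv m W x|) := by ring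
    _ ≤ γ ^ k * (K * (M * cellh pt j ^ (k + 1))) := by
        gcongr
    _ ≤ γ ^ k * (K * (M * meshSize pt ^ (k + 1))) := by
        have := cellh_le_meshSize pt j
        gcongr
    _ = _ := by ring

/-- The upwind form is bounded by inverse inequalities. -/
lemma sq_dgRHS_le [NeZero N] {pt : Fin (N + 1) → ℝ} (hpt : IsMesh pt) {k : ℕ} (hk : 1 ≤ k)
    {K : ℝ} (hK : 0 < K) (hinv : ∀ (j : Fin N) (p : ℝ[X]), p.natDegree ≤ k → ∀ m ≤ k,
      ∀ x ∈ Set.Icc (ptL pt j) (ptR pt j),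
      meshSize pt * (meshSize pt ^ m * (pderiv m p).eval x) ^ 2 ≤ K * cip pt j p p)
    (β : ℝ) {z : Fin N → ℝ[X]} (hz : MemVk k z) (j : Fin N) {v : ℝ[X]} (hv : v.natDegree ≤ k) :
    (meshSize pt * dgRHS pt β z j v) ^ 2 ≤ 3 * β ^ 2 * (K + K ^ 2) *
      ((cip pt j (z j) (z j) + cip pt (j - 1) (z (j - 1)) (z (j - 1))) * cip pt j v v) := by
  set h := meshSize pt with hh
  have hh0 : 0 < h := meshSize_pos hpt
  have hlt := ptL_lt_ptR hpt
  have hpv : ∀ (i : Fin N) (p : ℝ[X]), p.natDegree ≤ k → ∀ x ∈ Set.Icc (ptL pt i) (ptR pt i),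
      h * p.eval x ^ 2 ≤ K * cip pt i p p := fun i p hp x hx => by
    simpa using hinv i p hp 0 (Nat.zero_le _) x hx
  have n1 := cip_self_nonneg hpt j (z j)
  have n2 := cip_self_nonneg hpt (j - 1) (z (j - 1))
  have n3 := cip_self_nonneg hpt j v
  have hvol : (h * ∫ x in (ptL pt j)..(ptR pt j), (z j).eval x * (derivative v).eval x) ^ 2 ≤
      K * (cip pt j (z j) (z j) * cip pt j v v) := by
    have h1 := cip_sq_le hpt j (z j) (derivative v)
    have h2 : h ^ 2 * cip pt j (derivative v) (derivative v) ≤ K * cip pt j v v := by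
      have hsup : ∀ x ∈ Set.Icc (ptL pt j) (ptR pt j),
          |(derivative v).eval x| ≤ Real.sqrt (K * cip pt j v v / h ^ 3) := by
        intro x hx
        apply Real.abs_le_sqrt
        rw [le_div_iff₀ (by positivity)]
        have := hinv j v hv 1 hk x hx
        rw [pderiv_succ, pderiv_zero, pow_one] at this
        calc _ = h * (h * (derivative v).eval x) ^ 2 := by ring
          _ ≤ _ := this
      have := cip_self_le_of_abs_le hpt j hsup
      rw [Real.sq_sqrt (by positivity)] at this
      calc h ^ 2 * cip pt j (derivative v) (derivative v)
          ≤ h ^ 2 * (h * (K * cip pt j v v / h ^ 3)) := by gcongr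
        _ = _ := by field_simp
    calc _ = h ^ 2 * cip pt j (z j) (derivative v) ^ 2 := by
          rw [cip]
          ring
      _ ≤ h ^ 2 * (cip pt j (z j) (z j) * cip pt j (derivative v) (derivative v)) := by gcongr
      _ = cip pt j (z j) (z j) * (h ^ 2 * cip pt j (derivative v) (derivative v)) := by ring
      _ ≤ cip pt j (z j) (z j) * (K * cip pt j v v) := by gcongr
      _ = _ := by ring
  have hR : (h * ((z j).eval (ptR pt j) * v.eval (ptR pt j))) ^ 2 ≤
      K ^ 2 * (cip pt j (z j) (z j) * cip pt j v v) := by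
    have h1 := hpv j (z j) (hz j) (ptR pt j) ⟨(hlt j).le, le_rfl⟩
    have h2 := hpv j v hv (ptR pt j) ⟨(hlt j).le, le_rfl⟩
    calc _ = (h * (z j).eval (ptR pt j) ^ 2) * (h * v.eval (ptR pt j) ^ 2) := by ring
      _ ≤ (K * cip pt j (z j) (z j)) * (K * cip pt j v v) := by gcongr
      _ = _ := by ring
  have hL : (h * ((z (j - 1)).eval (ptR pt (j - 1)) * v.eval (ptL pt j))) ^ 2 ≤
      K ^ 2 * (cip pt (j - 1) (z (j - 1)) (z (j - 1)) * cip pt j v v) := by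
    have h1 := hpv (j - 1) (z (j - 1)) (hz (j - 1)) (ptR pt (j - 1)) ⟨(hlt (j - 1)).le, le_rfl⟩
    have h2 := hpv j v hv (ptL pt j) ⟨le_rfl, (hlt j).le⟩
    calc _ = (h * (z (j - 1)).eval (ptR pt (j - 1)) ^ 2) * (h * v.eval (ptL pt j) ^ 2) := by ring
      _ ≤ (K * cip pt (j - 1) (z (j - 1)) (z (j - 1))) * (K * cip pt j v v) := by gcongr
      _ = _ := by ring
  set A := h * ∫ x in (ptL pt j)..(ptR pt j), (z j).eval x * (derivative v).eval x with hA
  set B := h * ((z j).eval (ptR pt j) * v.eval (ptR pt j)) with hB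
  set D := h * ((z (j - 1)).eval (ptR pt (j - 1)) * v.eval (ptL pt j)) with hD
  have hrep : h * dgRHS pt β z j v = β * (A - B + D) := by
    rw [dgRHS, hA, hB, hD, ptR, ptR]
    ring
  rw [hrep, mul_pow]
  have h3 : (A - B + D) ^ 2 ≤ 3 * (A ^ 2 + B ^ 2 + D ^ 2) := by
    nlinarith [sq_nonneg (A + B), sq_nonneg (A - D), sq_nonneg (B + D)]
  have h4 : A ^ 2 + B ^ 2 + D ^ 2 ≤ (K + K ^ 2) *
      ((cip pt j (z j) (z j) + cip pt (j - 1) (z (j - 1)) (z (j - 1))) * cip pt j v v) := by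
    nlinarith [mul_nonneg hK.le (mul_nonneg n2 n3)]
  calc β ^ 2 * (A - B + D) ^ 2 ≤ β ^ 2 * (3 * ((K + K ^ 2) *
      ((cip pt j (z j) (z j) + cip pt (j - 1) (z (j - 1)) (z (j - 1))) * cip pt j v v))) := by
        gcongr
        linarith
    _ = _ := by ring

/-- Consistency: the upwind form of a Gauss–Radau projection is exact. -/
lemma dgRHS_radau [NeZero N] {pt : Fin (N + 1) → ℝ} (hpt : IsMesh pt) {k : ℕ} (hk : 1 ≤ k)
    (β : ℝ) {W : ℝ → ℝ} (hW : ContDiff ℝ (⊤ : ℕ∞) W) (hper : ∀ x, W (x + 1) = W x)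
    {p : Fin N → ℝ[X]} (hp : ∀ j, IsGRProj k (ptL pt j) (ptR pt j) W (p j)) (j : Fin N)
    {v : ℝ[X]} (hv : v.natDegree ≤ k) :
    dgRHS pt β p j v = -(β * ∫ x in (ptL pt j)..(ptR pt j), deriv W x * v.eval x) := by
  have hWc := hW.continuous
  have hpc := continuous_polynomial_eval (p j)
  have hvc := continuous_polynomial_eval v
  have hvc' := continuous_polynomial_eval (derivative v)
  have h1 := (hp j).2.1 (derivative v)
    (lt_of_le_of_lt (natDegree_derivative_le v) (by omega))
  have h2 : ∫ x in (ptL pt j)..(ptR pt j), (p j).eval x * (derivative v).eval x =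
      ∫ x in (ptL pt j)..(ptR pt j), W x * (derivative v).eval x := by
    rw [eq_comm, ← sub_eq_zero, ← intervalIntegral.integral_sub
      ((by fun_prop : Continuous fun x => W x * (derivative v).eval x).intervalIntegrable _ _)
      ((by fun_prop : Continuous fun x => (p j).eval x * (derivative v).eval x).intervalIntegrable
        _ _), ← h1]
    congr 1
    ext x
    ring
  have h3 := intervalIntegral.integral_mul_deriv_eq_deriv_mul (a := ptL pt j) (b := ptR pt j)
    (u := W) (v := fun x => v.eval x) (u' := deriv W) (v' := fun x => (derivative v).eval x)
    (fun x _ => (hW.differentiable (by simp) x).hasDerivAt) (fun x _ => v.hasDerivAt x)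
    ((contDiff_deriv_of_contDiff hW).continuous.intervalIntegrable _ _)
    (hvc'.intervalIntegrable _ _)
  have h4 : (p (j - 1)).eval (pt (j - 1).succ) = W (ptL pt j) := by
    have := periodic_interface hpt hper (j - 1)
    rw [sub_add_cancel] at this
    rw [this]
    exact (hp (j - 1)).2.2
  rw [dgRHS, h2, h3, h4, (hp j).2.2]
  ring

lemma dgRHS_sub [NeZero N] (pt : Fin (N + 1) → ℝ) (β : ℝ) (w z : Fin N → ℝ[X]) (j : Fin N)
    (v : ℝ[X]) : dgRHS pt β (fun j => w j - z j) j v = dgRHS pt β w j v - dgRHS pt β z j v := by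
  have h := cip_sub_left pt j (w j) (z j) (derivative v)
  simp only [cip] at h
  simp only [dgRHS, h]
  simp only [eval_sub]
  ring

lemma abs_le_of_sq_le_mul {t A x q : ℝ} (hA : 0 ≤ A) (hx : 0 ≤ x) (hq : 0 < q)
    (h : t ^ 2 ≤ A * x) : |t| ≤ x / (2 * q) + q * A / 2 := by
  refine abs_le_of_sq_le_sq (h.trans ?_) (by positivity)
  have h1 : x / (2 * q) * (q * A / 2) = A * x / 4 := by
    field_simp
    ring
  nlinarith [sq_nonneg (x / (2 * q) - q * A / 2)]

lemma MemVk.rkStage [NeZero N] {k : ℕ} {pt : Fin (N + 1) → ℝ} {β τ : ℝ} {c d : ℕ → ℕ → ℝ}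
    {L : (Fin N → ℝ[X]) → (Fin N → ℝ[X])} (hL : IsDGOp k pt β L) {ℓ : ℕ}
    {z : ℕ → Fin N → ℝ[X]} (hz : ∀ m ≤ ℓ, MemVk k (z m)) :
    MemVk k (OEDG.rkStage c d τ L z ℓ) := by
  intro j
  refine natDegree_sum_le_of_forall_le _ _ fun m hm => ?_
  have hm' := Nat.lt_succ_iff.mp (mem_range.mp hm)
  exact (natDegree_add_le _ _).trans (max_le ((natDegree_C_mul_le _ _).trans (hz m hm' j))
    ((natDegree_C_mul_le _ _).trans ((hL _ (hz m hm')).1 j)))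

/-- Local error equation of one Runge–Kutta stage. -/
lemma stage_error_identity [NeZero N] {pt : Fin (N + 1) → ℝ} (hpt : IsMesh pt) {k : ℕ}
    (hk : 1 ≤ k) {β τ : ℝ} {c d : ℕ → ℕ → ℝ} {ℓ : ℕ} {W : ℕ → ℝ → ℝ}
    (hW : ∀ m, ContDiff ℝ (⊤ : ℕ∞) (W m)) (hper : ∀ m x, W m (x + 1) = W m x)
    {p : ℕ → Fin N → ℝ[X]} (hp : ∀ m j, IsGRProj k (ptL pt j) (ptR pt j) (W m) (p m j))
    {z : ℕ → Fin N → ℝ[X]} (hz : ∀ m ≤ ℓ, MemVk k (z m))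
    {L : (Fin N → ℝ[X]) → (Fin N → ℝ[X])} (hL : IsDGOp k pt β L)
    {ρ : ℝ → ℝ} (hρ : Continuous ρ)
    (hrec : ∀ x, W (ℓ + 1) x = ∑ m ∈ range (ℓ + 1),
      (c ℓ m * W m x - τ * d ℓ m * β * deriv (W m) x) + ρ x)
    (j : Fin N) {v : ℝ[X]} (hv : v.natDegree ≤ k) :
    cip pt j (rkStage c d τ L z ℓ j - p (ℓ + 1) j) v = ∑ m ∈ range (ℓ + 1),
        (c ℓ m * cip pt j (z m j - p m j) v
          + τ * d ℓ m * dgRHS pt β (fun i => z m i - p m i) j v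
          - c ℓ m * ∫ x in (ptL pt j)..(ptR pt j), (W m x - (p m j).eval x) * v.eval x)
      + (∫ x in (ptL pt j)..(ptR pt j), (W (ℓ + 1) x - (p (ℓ + 1) j).eval x) * v.eval x)
      - ∫ x in (ptL pt j)..(ptR pt j), ρ x * v.eval x := by
  have hWc : ∀ m, Continuous (W m) := fun m => (hW m).continuous
  have hWd : ∀ m, Continuous (deriv (W m)) :=
    fun m => (contDiff_deriv_of_contDiff (hW m)).continuous
  have hη : ∀ m, ∫ x in (ptL pt j)..(ptR pt j), (W m x - (p m j).eval x) * v.eval x =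
      (∫ x in (ptL pt j)..(ptR pt j), W m x * v.eval x) - cip pt j (p m j) v := by
    intro m
    have := hWc m
    rw [cip, ← intervalIntegral.integral_sub]
    · congr 1
      ext x
      ring
    · exact (by fun_prop : Continuous fun x => W m x * v.eval x).intervalIntegrable _ _
    · exact (by fun_prop : Continuous fun x => (p m j).eval x * v.eval x).intervalIntegrable _ _
  have hWint : ∫ x in (ptL pt j)..(ptR pt j), W (ℓ + 1) x * v.eval x =
      ∑ m ∈ range (ℓ + 1), (c ℓ m * (∫ x in (ptL pt j)..(ptR pt j), W m x * v.eval x)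
        - τ * d ℓ m * β * ∫ x in (ptL pt j)..(ptR pt j), deriv (W m) x * v.eval x)
      + ∫ x in (ptL pt j)..(ptR pt j), ρ x * v.eval x := by
    have e : (fun x => W (ℓ + 1) x * v.eval x) = fun x => (∑ m ∈ range (ℓ + 1),
        (c ℓ m * (W m x * v.eval x) - τ * d ℓ m * β * (deriv (W m) x * v.eval x)))
        + ρ x * v.eval x := by
      ext x
      rw [hrec, add_mul, Finset.sum_mul]
      congr 1
      exact Finset.sum_congr rfl fun m _ => by ring
    have hc1 : ∀ m, Continuous fun x => c ℓ m * (W m x * v.eval x) := fun m => by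
      have := hWc m
      fun_prop
    have hc2 : ∀ m, Continuous fun x => τ * d ℓ m * β * (deriv (W m) x * v.eval x) := fun m => by
      have := hWd m
      fun_prop
    rw [e, intervalIntegral.integral_add, intervalIntegral.integral_finsetSum]
    · congr 1
      refine Finset.sum_congr rfl fun m _ => ?_
      rw [intervalIntegral.integral_sub ((hc1 m).intervalIntegrable _ _)
        ((hc2 m).intervalIntegrable _ _), intervalIntegral.integral_const_mul,
        intervalIntegral.integral_const_mul]
    · exact fun m _ => ((hc1 m).sub (hc2 m)).intervalIntegrable _ _
    · exact (continuous_finsetSum _ fun m _ => (hc1 m).sub (hc2 m)).intervalIntegrable _ _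
    · exact (by fun_prop : Continuous fun x => ρ x * v.eval x).intervalIntegrable _ _
  rw [hη, hWint, cip_sub_left, rkStage, cip_sum_left]
  have : ∀ m ∈ range (ℓ + 1),
      cip pt j (C (c ℓ m) * z m j + C (τ * d ℓ m) * L (z m) j) v =
      c ℓ m * cip pt j (z m j - p m j) v
          + τ * d ℓ m * dgRHS pt β (fun i => z m i - p m i) j v
          - c ℓ m * (∫ x in (ptL pt j)..(ptR pt j), (W m x - (p m j).eval x) * v.eval x)
        + (c ℓ m * (∫ x in (ptL pt j)..(ptR pt j), W m x * v.eval x)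
        - τ * d ℓ m * β * ∫ x in (ptL pt j)..(ptR pt j), deriv (W m) x * v.eval x) := by
    intro m hm
    rw [cip_add_left, cip_C_mul_left, cip_C_mul_left,
      ((hL (z m) (hz m (Nat.lt_succ_iff.mp (mem_range.mp hm)))).2 j v hv), hη, cip_sub_left,
      dgRHS_sub, dgRHS_radau hpt hk β (hW m) (hper m) (hp m) j hv]
    ring
  rw [Finset.sum_congr rfl this, Finset.sum_add_distrib]
  ring

/-- Cellwise error bound for one Runge–Kutta stage. -/
lemma cip_stage_error_le [NeZero N] {pt : Fin (N + 1) → ℝ} (hpt : IsMesh pt) {k : ℕ}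
    (hk : 1 ≤ k) {K : ℝ} (hK : 0 < K) (hinv : ∀ (j : Fin N) (p : ℝ[X]), p.natDegree ≤ k →
      ∀ m ≤ k, ∀ x ∈ Set.Icc (ptL pt j) (ptR pt j),
      meshSize pt * (meshSize pt ^ m * (pderiv m p).eval x) ^ 2 ≤ K * cip pt j p p)
    {β τ CCFL : ℝ} (hτ : 0 ≤ τ) (hCFL : τ ≤ CCFL * meshSize pt)
    {c d : ℕ → ℕ → ℝ} {ℓ : ℕ} {D : ℝ} (hD : ∀ m ≤ ℓ, c ℓ m ^ 2 ≤ D ∧ d ℓ m ^ 2 ≤ D)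
    {W : ℕ → ℝ → ℝ}
    (hW : ∀ m, ContDiff ℝ (⊤ : ℕ∞) (W m)) (hper : ∀ m x, W m (x + 1) = W m x)
    {p : ℕ → Fin N → ℝ[X]} (hp : ∀ m j, IsGRProj k (ptL pt j) (ptR pt j) (W m) (p m j))
    {B : ℝ} (hB : ∀ m ≤ ℓ + 1, ∀ j, ∀ x ∈ Set.Icc (ptL pt j) (ptR pt j),
      |W m x - (p m j).eval x| ≤ B)
    {z : ℕ → Fin N → ℝ[X]} (hz : ∀ m ≤ ℓ, MemVk k (z m))
    {L : (Fin N → ℝ[X]) → (Fin N → ℝ[X])} (hL : IsDGOp k pt β L)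
    {ρ : ℝ → ℝ} (hρ : Continuous ρ)
    (hrec : ∀ x, W (ℓ + 1) x = ∑ m ∈ range (ℓ + 1),
      (c ℓ m * W m x - τ * d ℓ m * β * deriv (W m) x) + ρ x) (j : Fin N) :
    cip pt j (rkStage c d τ L z ℓ j - p (ℓ + 1) j) (rkStage c d τ L z ℓ j - p (ℓ + 1) j) ≤
      (3 * ((ℓ : ℝ) + 1) + 2) * (∑ m ∈ range (ℓ + 1),
        (D * cip pt j (z m j - p m j) (z m j - p m j)
          + D * CCFL ^ 2 * (3 * β ^ 2 * (K + K ^ 2)) * (cip pt j (z m j - p m j) (z m j - p m j) +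
            cip pt (j - 1) (z m (j - 1) - p m (j - 1)) (z m (j - 1) - p m (j - 1)))
          + D * (cellh pt j * B ^ 2))
        + cellh pt j * B ^ 2 + ∫ x in (ptL pt j)..(ptR pt j), ρ x ^ 2) := by
  have hzp : ∀ m ≤ ℓ, MemVk k fun i => z m i - p m i := fun m hm i =>
    (natDegree_sub_le _ _).trans (max_le (hz m hm i) (hp m i).1)
  have hlt := ptL_lt_ptR hpt
  set ξ := rkStage c d τ L z ℓ j - p (ℓ + 1) j with hξ
  have hξk : ξ.natDegree ≤ k := by
    exact (natDegree_sub_le _ _).trans (max_le (MemVk.rkStage hL hz j) (hp _ j).1)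
  have hid := stage_error_identity hpt hk hW hper hp hz hL hρ hrec j hξk
  rw [← hξ] at hid
  set X := cip pt j ξ ξ with hX
  have hX0 : 0 ≤ X := cip_self_nonneg hpt j ξ
  set q : ℝ := 3 * ((ℓ : ℝ) + 1) + 2 with hq
  have hq0 : 0 < q := by positivity
  have hD0 : 0 ≤ D := (sq_nonneg _).trans (hD 0 (Nat.zero_le _)).1
  have hh := meshSize_pos hpt
  have hη : ∀ m ≤ ℓ + 1, (∫ x in (ptL pt j)..(ptR pt j),
      (W m x - (p m j).eval x) * ξ.eval x) ^ 2 ≤ (cellh pt j * B ^ 2) * X := by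
    intro m hm
    have hWc := (hW m).continuous
    refine (integral_mul_sq_le (hlt j).le (by fun_prop) ξ.continuous).trans ?_
    rw [hX, cip_self_eq]
    refine mul_le_mul_of_nonneg_right (integral_sq_le_of_abs_le (hlt j).le (hB m hm j)) ?_
    exact intervalIntegral.integral_nonneg (hlt j).le fun x _ => sq_nonneg _
  have hρX : (∫ x in (ptL pt j)..(ptR pt j), ρ x * ξ.eval x) ^ 2 ≤
      (∫ x in (ptL pt j)..(ptR pt j), ρ x ^ 2) * X := by
    rw [hX, cip_self_eq]
    exact integral_mul_sq_le (hlt j).le hρ ξ.continuous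
  have hρ0 : 0 ≤ ∫ x in (ptL pt j)..(ptR pt j), ρ x ^ 2 :=
    intervalIntegral.integral_nonneg (hlt j).le fun x _ => sq_nonneg _
  have hcj := cellh_pos hpt j
  have hterm : ∀ m ∈ range (ℓ + 1), c ℓ m * cip pt j (z m j - p m j) ξ
          + τ * d ℓ m * dgRHS pt β (fun i => z m i - p m i) j ξ
          - c ℓ m * (∫ x in (ptL pt j)..(ptR pt j), (W m x - (p m j).eval x) * ξ.eval x) ≤
      3 * (X / (2 * q)) + q / 2 * (D * cip pt j (z m j - p m j) (z m j - p m j)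
          + D * CCFL ^ 2 * (3 * β ^ 2 * (K + K ^ 2)) * (cip pt j (z m j - p m j) (z m j - p m j) +
            cip pt (j - 1) (z m (j - 1) - p m (j - 1)) (z m (j - 1) - p m (j - 1)))
          + D * (cellh pt j * B ^ 2)) := by
    intro m hm
    have hm' := Nat.lt_succ_iff.mp (mem_range.mp hm)
    obtain ⟨hDc, hDd⟩ := hD m hm'
    have n1 := cip_self_nonneg hpt j (z m j - p m j)
    have n2 := cip_self_nonneg hpt (j - 1) (z m (j - 1) - p m (j - 1))
    have t1 : (c ℓ m * cip pt j (z m j - p m j) ξ) ^ 2 ≤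
        (D * cip pt j (z m j - p m j) (z m j - p m j)) * X := by
      rw [mul_pow, mul_assoc]
      exact mul_le_mul hDc (cip_sq_le hpt j _ _) (sq_nonneg _) hD0
    have t2 : (τ * d ℓ m * dgRHS pt β (fun i => z m i - p m i) j ξ) ^ 2 ≤
        (D * CCFL ^ 2 * (3 * β ^ 2 * (K + K ^ 2)) * (cip pt j (z m j - p m j) (z m j - p m j) +
            cip pt (j - 1) (z m (j - 1) - p m (j - 1)) (z m (j - 1) - p m (j - 1)))) * X := by
      have := sq_dgRHS_le hpt hk hK hinv β (hzp m hm') j hξk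
      calc _ = d ℓ m ^ 2 * (τ ^ 2 * dgRHS pt β (fun i => z m i - p m i) j ξ ^ 2) := by ring
        _ ≤ D * ((CCFL * meshSize pt) ^ 2 * dgRHS pt β (fun i => z m i - p m i) j ξ ^ 2) := by
          gcongr
        _ = D * CCFL ^ 2 * (meshSize pt * dgRHS pt β (fun i => z m i - p m i) j ξ) ^ 2 := by ring
        _ ≤ D * CCFL ^ 2 * _ := mul_le_mul_of_nonneg_left this (by positivity)
        _ = _ := by
          rw [hX]
          ring
    have t3 : (c ℓ m * ∫ x in (ptL pt j)..(ptR pt j),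
        (W m x - (p m j).eval x) * ξ.eval x) ^ 2 ≤ (D * (cellh pt j * B ^ 2)) * X := by
      rw [mul_pow, mul_assoc]
      exact mul_le_mul hDc (hη m (by omega)) (sq_nonneg _) hD0
    have b1 := abs_le.mp (abs_le_of_sq_le_mul (by positivity) hX0 hq0 t1)
    have b2 := abs_le.mp (abs_le_of_sq_le_mul (by positivity) hX0 hq0 t2)
    have b3 := abs_le.mp (abs_le_of_sq_le_mul (by positivity) hX0 hq0 t3)
    linarith [b1.2, b2.2, b3.1]
  have b4 := abs_le.mp (abs_le_of_sq_le_mul (by positivity) hX0 hq0 (hη (ℓ + 1) le_rfl))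
  have b5 := abs_le.mp (abs_le_of_sq_le_mul hρ0 hX0 hq0 hρX)
  have hs := Finset.sum_le_sum hterm
  rw [Finset.sum_add_distrib, Finset.sum_const, card_range, nsmul_eq_mul, ← Finset.mul_sum] at hs
  have hx2 : X / 2 = (3 * ((ℓ : ℝ) + 1) + 2) * (X / (2 * q)) := by
    rw [← hq]
    field_simp
  push_cast at hs
  linarith [b4.2, b5.1]

lemma sum_sub_one [NeZero N] (f : Fin N → ℝ) : ∑ j, f (j - 1) = ∑ j, f j :=
  Equiv.sum_comp (Equiv.subRight (1 : Fin N)) f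

lemma sum_add_one [NeZero N] (f : Fin N → ℝ) : ∑ j, f (j + 1) = ∑ j, f j :=
  Equiv.sum_comp (Equiv.addRight (1 : Fin N)) f

lemma ip_self_nonneg {pt : Fin (N + 1) → ℝ} (hpt : IsMesh pt) (w : Fin N → ℝ[X]) :
    0 ≤ ip pt w w := Finset.sum_nonneg fun j _ => cip_self_nonneg hpt j (w j)

/-- Error bound for one Runge–Kutta stage. -/
lemma ip_stage_error_le [NeZero N] {pt : Fin (N + 1) → ℝ} (hpt : IsMesh pt) {k : ℕ}
    (hk : 1 ≤ k) {K : ℝ} (hK : 0 < K) (hinv : ∀ (j : Fin N) (p : ℝ[X]), p.natDegree ≤ k →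
      ∀ m ≤ k, ∀ x ∈ Set.Icc (ptL pt j) (ptR pt j),
      meshSize pt * (meshSize pt ^ m * (pderiv m p).eval x) ^ 2 ≤ K * cip pt j p p)
    {β τ CCFL : ℝ} (hτ : 0 ≤ τ) (hCFL : τ ≤ CCFL * meshSize pt)
    {c d : ℕ → ℕ → ℝ} {ℓ : ℕ} {D : ℝ} (hD : ∀ m ≤ ℓ, c ℓ m ^ 2 ≤ D ∧ d ℓ m ^ 2 ≤ D)
    {W : ℕ → ℝ → ℝ}
    (hW : ∀ m, ContDiff ℝ (⊤ : ℕ∞) (W m)) (hper : ∀ m x, W m (x + 1) = W m x)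
    {p : ℕ → Fin N → ℝ[X]} (hp : ∀ m j, IsGRProj k (ptL pt j) (ptR pt j) (W m) (p m j))
    {B : ℝ} (hB : ∀ m ≤ ℓ + 1, ∀ j, ∀ x ∈ Set.Icc (ptL pt j) (ptR pt j),
      |W m x - (p m j).eval x| ≤ B)
    {z : ℕ → Fin N → ℝ[X]} (hz : ∀ m ≤ ℓ, MemVk k (z m))
    {L : (Fin N → ℝ[X]) → (Fin N → ℝ[X])} (hL : IsDGOp k pt β L)
    {ρ : ℝ → ℝ} (hρ : Continuous ρ)
    (hrec : ∀ x, W (ℓ + 1) x = ∑ m ∈ range (ℓ + 1),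
      (c ℓ m * W m x - τ * d ℓ m * β * deriv (W m) x) + ρ x) :
    ip pt (fun j => rkStage c d τ L z ℓ j - p (ℓ + 1) j)
        (fun j => rkStage c d τ L z ℓ j - p (ℓ + 1) j) ≤
      (3 * ((ℓ : ℝ) + 1) + 2) * (D + 2 * (D * CCFL ^ 2 * (3 * β ^ 2 * (K + K ^ 2)))
          + (((ℓ : ℝ) + 1) * D + 1)) *
        (∑ m ∈ range (ℓ + 1), ip pt (fun j => z m j - p m j) (fun j => z m j - p m j) + B ^ 2
          + ∫ x in (0 : ℝ)..1, ρ x ^ 2) := by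
  have hD0 : 0 ≤ D := (sq_nonneg _).trans (hD 0 (Nat.zero_le _)).1
  have hsum := Finset.sum_le_sum fun j (_ : j ∈ univ) =>
    cip_stage_error_le hpt hk hK hinv hτ hCFL hD hW hper hp hB hz hL hρ hrec j
  have hip : ∀ m, ∑ j : Fin N, (D * cip pt j (z m j - p m j) (z m j - p m j)
          + D * CCFL ^ 2 * (3 * β ^ 2 * (K + K ^ 2)) * (cip pt j (z m j - p m j) (z m j - p m j) +
            cip pt (j - 1) (z m (j - 1) - p m (j - 1)) (z m (j - 1) - p m (j - 1)))
          + D * (cellh pt j * B ^ 2)) =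
      (D + 2 * (D * CCFL ^ 2 * (3 * β ^ 2 * (K + K ^ 2)))) *
        ip pt (fun j => z m j - p m j) (fun j => z m j - p m j) + D * B ^ 2 := by
    intro m
    rw [Finset.sum_add_distrib, Finset.sum_add_distrib, ← Finset.mul_sum, ← Finset.mul_sum,
      ← Finset.mul_sum, ← Finset.sum_mul, sum_cellh hpt, Finset.sum_add_distrib,
      sum_sub_one fun j => cip pt j (z m j - p m j) (z m j - p m j), ip]
    ring
  rw [← Finset.mul_sum, Finset.sum_add_distrib, Finset.sum_add_distrib, Finset.sum_comm,
    Finset.sum_congr rfl fun m _ => hip m, sum_cell_integral hpt (f := fun x => ρ x ^ 2) (by fun_prop), ← Finset.sum_mul,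
    sum_cellh hpt, Finset.sum_add_distrib, ← Finset.mul_sum, Finset.sum_const, card_range,
    nsmul_eq_mul] at hsum
  have hS : 0 ≤ ∑ m ∈ range (ℓ + 1), ip pt (fun j => z m j - p m j) (fun j => z m j - p m j) :=
    Finset.sum_nonneg fun m _ => ip_self_nonneg hpt _
  have hR : 0 ≤ ∫ x in (0 : ℝ)..1, ρ x ^ 2 :=
    intervalIntegral.integral_nonneg zero_le_one fun x _ => sq_nonneg _
  refine hsum.trans ?_
  rw [mul_assoc (3 * ((ℓ : ℝ) + 1) + 2)]
  refine mul_le_mul_of_nonneg_left ?_ (by positivity)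
  push_cast
  set S := ∑ m ∈ range (ℓ + 1), ip pt (fun j => z m j - p m j) (fun j => z m j - p m j)
  set R := ∫ x in (0 : ℝ)..1, ρ x ^ 2
  set G := D + 2 * (D * CCFL ^ 2 * (3 * β ^ 2 * (K + K ^ 2))) with hG
  have hG0 : 0 ≤ G := by positivity
  have hF0 : 0 ≤ ((ℓ : ℝ) + 1) * D := by positivity
  have hB0 := sq_nonneg B
  nlinarith [mul_nonneg hG0 hB0, mul_nonneg hG0 hR, mul_nonneg hF0 hS, mul_nonneg hF0 hR]

/-- Interface jumps of `v` are controlled by the distance of `v` to a smooth function. -/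
lemma jumpD_sq_le [NeZero N] {pt : Fin (N + 1) → ℝ} (hpt : IsMesh pt) {k : ℕ}
    {K : ℝ} (hinv : ∀ (j : Fin N) (p : ℝ[X]), p.natDegree ≤ k →
      ∀ m ≤ k, ∀ x ∈ Set.Icc (ptL pt j) (ptR pt j),
      meshSize pt * (meshSize pt ^ m * (pderiv m p).eval x) ^ 2 ≤ K * cip pt j p p)
    {W : ℝ → ℝ} (hper : ∀ x, W (x + 1) = W x) {v p : Fin N → ℝ[X]}
    (hvp : MemVk k fun j => v j - p j) {B : ℝ} {m : ℕ} (hm : m ≤ k)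
    (hB : ∀ (j : Fin N), ∀ x ∈ Set.Icc (ptL pt j) (ptR pt j),
      |meshSize pt ^ m * ((pderiv m (p j)).eval x - iteratedDeriv m W x)| ≤ B) (j : Fin N) :
    meshSize pt * (meshSize pt ^ m * jumpD pt v m j) ^ 2 ≤
      3 * K * (cip pt (j + 1) (v (j + 1) - p (j + 1)) (v (j + 1) - p (j + 1)) +
        cip pt j (v j - p j) (v j - p j)) + 12 * (meshSize pt * B ^ 2) := by
  have hh := meshSize_pos hpt
  have hL : ptL pt (j + 1) ∈ Set.Icc (ptL pt (j + 1)) (ptR pt (j + 1)) :=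
    ⟨le_rfl, (ptL_lt_ptR hpt _).le⟩
  have hR : ptR pt j ∈ Set.Icc (ptL pt j) (ptR pt j) := ⟨(ptL_lt_ptR hpt _).le, le_rfl⟩
  have h1 := hinv (j + 1) _ (hvp (j + 1)) m hm _ hL
  have h2 := hinv j _ (hvp j) m hm _ hR
  have b1 := abs_le.mp (hB (j + 1) _ hL)
  have b2 := abs_le.mp (hB j _ hR)
  rw [periodic_interface hpt (g := iteratedDeriv m W) (iteratedDeriv_periodic hper m) j] at b1
  rw [pderiv_sub, eval_sub] at h1 h2
  set a := meshSize pt ^ m * ((pderiv m (v (j + 1))).eval (ptL pt (j + 1))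
    - (pderiv m (p (j + 1))).eval (ptL pt (j + 1))) with ha
  set b := meshSize pt ^ m * ((pderiv m (v j)).eval (ptR pt j)
    - (pderiv m (p j)).eval (ptR pt j)) with hb
  set e := meshSize pt ^ m * ((pderiv m (p (j + 1))).eval (ptL pt (j + 1))
    - iteratedDeriv m W (ptR pt j)) with he
  set f := meshSize pt ^ m * ((pderiv m (p j)).eval (ptR pt j)
    - iteratedDeriv m W (ptR pt j)) with hf
  have hJ : meshSize pt ^ m * jumpD pt v m j = a - b + (e - f) := by
    rw [jumpD, ha, hb, he, hf, ptL, ptR]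
    ring
  have hef : (e - f) ^ 2 ≤ 4 * B ^ 2 := by
    have : |e - f| ≤ 2 * B := abs_le.mpr ⟨by linarith, by linarith⟩
    calc (e - f) ^ 2 = |e - f| ^ 2 := (sq_abs _).symm
      _ ≤ (2 * B) ^ 2 := by gcongr
      _ = _ := by ring
  have h3 : (a - b + (e - f)) ^ 2 ≤ 3 * (a ^ 2 + b ^ 2 + (e - f) ^ 2) := by
    nlinarith [sq_nonneg (a + b), sq_nonneg (a - (e - f)), sq_nonneg (b + (e - f))]
  rw [hJ]
  calc meshSize pt * (a - b + (e - f)) ^ 2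
      ≤ meshSize pt * (3 * (a ^ 2 + b ^ 2 + 4 * B ^ 2)) := by
        gcongr
        linarith
    _ = 3 * (meshSize pt * a ^ 2 + meshSize pt * b ^ 2) + 12 * (meshSize pt * B ^ 2) := by ring
    _ ≤ _ := by linarith

lemma sigma_nonneg [NeZero N] {pt : Fin (N + 1) → ℝ} (hpt : IsMesh pt) {k : ℕ} (hk : 1 ≤ k)
    (v : Fin N → ℝ[X]) (hv : 0 ≤ linfSub pt v (avg pt v)) (m : ℕ) (j : Fin N) :
    0 ≤ sigma k pt v m j := by
  rw [sigma]
  split_ifs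
  · exact le_rfl
  · have h1 := cellh_pos hpt j
    have h2 : (0 : ℝ) < 2 * k - 1 := by
      have : (1 : ℝ) ≤ k := by exact_mod_cast hk
      linarith
    positivity

lemma sigma_le [NeZero N] {pt : Fin (N + 1) → ℝ} (hpt : IsMesh pt) {k : ℕ} (hk : 1 ≤ k)
    {v : Fin N → ℝ[X]} {c0 : ℝ} (hc0 : 0 < c0) (hv : c0 ≤ linfSub pt v (avg pt v)) {m : ℕ}
    (hm : m ≤ k) (j : Fin N) :
    sigma k pt v m j ≤ (2 * k + 1) / (2 * c0) *
      (|meshSize pt ^ m * jumpD pt v m (j - 1)| + |meshSize pt ^ m * jumpD pt v m j|) := by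
  have hh := meshSize_pos hpt
  rw [abs_mul, abs_mul, abs_of_pos (by positivity : 0 < meshSize pt ^ m), sigma]
  split_ifs
  · positivity
  · have h1 := cellh_pos hpt j
    have hk' : (1 : ℝ) ≤ k := by exact_mod_cast hk
    have h3 : (1 : ℝ) ≤ (2 * k - 1) * (m.factorial : ℝ) := by
      have : (1 : ℝ) ≤ m.factorial := by exact_mod_cast Nat.succ_le_of_lt (Nat.factorial_pos m)
      nlinarith
    have hm' : (m : ℝ) ≤ k := by exact_mod_cast hm
    have h4 := cellh_le_meshSize pt j
    have hv0 := hc0.trans_le hv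
    have h5 : (2 * (m : ℝ) + 1) * cellh pt j ^ m / ((2 * k - 1) * (m.factorial : ℝ)) ≤
        (2 * k + 1) * meshSize pt ^ m := by
      refine (div_le_self (by positivity) h3).trans ?_
      gcongr
    calc _ ≤ (2 * k + 1) * meshSize pt ^ m *
          ((|jumpD pt v m (j - 1)| + |jumpD pt v m j|) / (2 * c0)) := by
          gcongr
      _ = _ := by
          field_simp

/-- Cellwise bound of the change produced by the damping step. -/
lemma cip_damping_le [NeZero N] {pt : Fin (N + 1) → ℝ} (hpt : IsMesh pt) {k : ℕ} (hk : 1 ≤ k)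
    {γ K : ℝ} (hγ : QuasiUniform pt γ) (hinv : ∀ (j : Fin N) (p : ℝ[X]), p.natDegree ≤ k →
      ∀ m ≤ k, ∀ x ∈ Set.Icc (ptL pt j) (ptR pt j),
      meshSize pt * (meshSize pt ^ m * (pderiv m p).eval x) ^ 2 ≤ K * cip pt j p p)
    {W : ℝ → ℝ} (hper : ∀ x, W (x + 1) = W x) {v p : Fin N → ℝ[X]}
    (hvp : MemVk k fun j => v j - p j) {B : ℝ}
    (hB : ∀ m ≤ k, ∀ (j : Fin N), ∀ x ∈ Set.Icc (ptL pt j) (ptR pt j),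
      |meshSize pt ^ m * ((pderiv m (p j)).eval x - iteratedDeriv m W x)| ≤ B)
    {Bv : ℝ} (hBv : ∀ (j : Fin N), ∀ x ∈ Set.Icc (ptL pt j) (ptR pt j), |(v j).eval x| ≤ Bv)
    {c0 : ℝ} (hc0 : 0 < c0) (hv : c0 ≤ linfSub pt v (avg pt v))
    {β τ CCFL : ℝ} (hβ : 0 ≤ β) (hτ : 0 ≤ τ) (hC : 0 ≤ CCFL) (hCFL : τ ≤ CCFL * meshSize pt)
    {Pc : Fin N → ℕ → ℝ[X] → ℝ[X]} (hPc : IsCellProj pt Pc) {w : ℝ → Fin N → ℝ[X]}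
    (hw : IsDampingSol k pt (fun _ => β) Pc v w) (j : Fin N) :
    cip pt j (w τ j - v j) (w τ j - v j) ≤
      (β * CCFL * γ * (k + 1) * ((2 * k + 1) / (2 * c0)) * Bv) ^ 2 * 2 *
      (3 * K * (cip pt (j - 1) (v (j - 1) - p (j - 1)) (v (j - 1) - p (j - 1)) +
        2 * cip pt j (v j - p j) (v j - p j) +
        cip pt (j + 1) (v (j + 1) - p (j + 1)) (v (j + 1) - p (j + 1)))
        + 24 * (meshSize pt * B ^ 2)) := by
  have hh := meshSize_pos hpt
  have hj := cellh_pos hpt j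
  have hσ0 := sigma_nonneg hpt hk v (hc0.le.trans hv)
  set S := 3 * K * (cip pt (j - 1) (v (j - 1) - p (j - 1)) (v (j - 1) - p (j - 1)) +
        2 * cip pt j (v j - p j) (v j - p j) +
        cip pt (j + 1) (v (j + 1) - p (j + 1)) (v (j + 1) - p (j + 1)))
        + 24 * (meshSize pt * B ^ 2) with hS
  have hσ : ∀ m ∈ range (k + 1), meshSize pt * sigma k pt v m j ^ 2 ≤
      ((2 * k + 1) / (2 * c0)) ^ 2 * (2 * S) := by
    intro m hm
    have hm' := Nat.lt_succ_iff.mp (mem_range.mp hm)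
    have h1 := jumpD_sq_le hpt hinv hper hvp hm' (hB m hm') (j - 1)
    have h2 := jumpD_sq_le hpt hinv hper hvp hm' (hB m hm') j
    rw [sub_add_cancel] at h1
    have h3 := sigma_le hpt hk hc0 hv hm' j
    set a := meshSize pt ^ m * jumpD pt v m (j - 1)
    set b := meshSize pt ^ m * jumpD pt v m j
    have h4 : (|a| + |b|) ^ 2 ≤ 2 * (a ^ 2 + b ^ 2) := by
      rw [← sq_abs a, ← sq_abs b]
      nlinarith [sq_nonneg (|a| - |b|)]
    calc meshSize pt * sigma k pt v m j ^ 2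
        ≤ meshSize pt * ((2 * k + 1) / (2 * c0) * (|a| + |b|)) ^ 2 := by
          have := hσ0 m j
          gcongr
      _ = ((2 * k + 1) / (2 * c0)) ^ 2 * (meshSize pt * (|a| + |b|) ^ 2) := by ring
      _ ≤ ((2 * k + 1) / (2 * c0)) ^ 2 * (meshSize pt * (2 * (a ^ 2 + b ^ 2))) := by gcongr
      _ = ((2 * k + 1) / (2 * c0)) ^ 2 * (2 * (meshSize pt * a ^ 2 + meshSize pt * b ^ 2)) := by
          ring
      _ ≤ ((2 * k + 1) / (2 * c0)) ^ 2 * (2 * S) := by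
          gcongr
          rw [hS]
          linarith
  have hδ : ∀ m, 0 ≤ dampRate k pt (fun _ => β) v m j := fun m =>
    div_nonneg (mul_nonneg hβ (hσ0 m j)) hj.le
  have hτΛ : τ * ∑ m ∈ range (k + 1), dampRate k pt (fun _ => β) v m j ≤
      β * CCFL * γ * ∑ m ∈ range (k + 1), sigma k pt v m j := by
    have hτj : τ / cellh pt j ≤ CCFL * γ := by
      rw [div_le_iff₀ hj, mul_assoc]
      exact hCFL.trans (mul_le_mul_of_nonneg_left (hγ j) hC)
    rw [Finset.mul_sum, Finset.mul_sum]
    refine Finset.sum_le_sum fun m _ => ?_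
    calc τ * dampRate k pt (fun _ => β) v m j = β * (τ / cellh pt j) * sigma k pt v m j := by
          rw [dampRate]
          ring
      _ ≤ β * (CCFL * γ) * sigma k pt v m j := by
          have := hσ0 m j
          gcongr
      _ = _ := by ring
  have hΛ : meshSize pt * (τ * ∑ m ∈ range (k + 1), dampRate k pt (fun _ => β) v m j) ^ 2 ≤
      (β * CCFL * γ) ^ 2 * (((k : ℝ) + 1) ^ 2 * (((2 * k + 1) / (2 * c0)) ^ 2 * (2 * S))) := by
    have hs1 := sq_sum_le_card_mul_sum_sq (s := range (k + 1)) (f := fun m => sigma k pt v m j)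
    have hs2 := Finset.sum_le_sum hσ
    rw [← Finset.mul_sum, Finset.sum_const, card_range, nsmul_eq_mul] at hs2
    rw [card_range] at hs1
    push_cast at hs1 hs2
    have hn : 0 ≤ τ * ∑ m ∈ range (k + 1), dampRate k pt (fun _ => β) v m j :=
      mul_nonneg hτ (Finset.sum_nonneg fun m _ => hδ m)
    calc _ ≤ meshSize pt * (β * CCFL * γ * ∑ m ∈ range (k + 1), sigma k pt v m j) ^ 2 := by
          gcongr
      _ = (β * CCFL * γ) ^ 2 * (meshSize pt * (∑ m ∈ range (k + 1), sigma k pt v m j) ^ 2) := by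
          ring
      _ ≤ (β * CCFL * γ) ^ 2 * (meshSize pt *
          (((k : ℝ) + 1) * ∑ m ∈ range (k + 1), sigma k pt v m j ^ 2)) := by gcongr
      _ = (β * CCFL * γ) ^ 2 * (((k : ℝ) + 1) *
          (meshSize pt * ∑ m ∈ range (k + 1), sigma k pt v m j ^ 2)) := by ring
      _ ≤ (β * CCFL * γ) ^ 2 * (((k : ℝ) + 1) *
          (((k : ℝ) + 1) * (((2 * k + 1) / (2 * c0)) ^ 2 * (2 * S)))) := by gcongr
      _ = _ := by ring
  calc _ ≤ (τ * ∑ m ∈ range (k + 1), dampRate k pt (fun _ => β) v m j) ^ 2 *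
        cip pt j (v j) (v j) := cip_damping_sub_le hpt hPc hw j hδ hτ
    _ ≤ (τ * ∑ m ∈ range (k + 1), dampRate k pt (fun _ => β) v m j) ^ 2 *
        (meshSize pt * Bv ^ 2) :=
        mul_le_mul_of_nonneg_left (cip_self_le_of_abs_le hpt j (hBv j)) (sq_nonneg _)
    _ = (meshSize pt * (τ * ∑ m ∈ range (k + 1), dampRate k pt (fun _ => β) v m j) ^ 2) *
        Bv ^ 2 := by ring
    _ ≤ (β * CCFL * γ) ^ 2 * (((k : ℝ) + 1) ^ 2 * (((2 * k + 1) / (2 * c0)) ^ 2 * (2 * S))) *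
        Bv ^ 2 := by gcongr
    _ = _ := by ring

/-- Bound of the change produced by the damping step. -/
lemma ip_damping_le [NeZero N] {pt : Fin (N + 1) → ℝ} (hpt : IsMesh pt) {k : ℕ} (hk : 1 ≤ k)
    {γ K : ℝ} (hγ : QuasiUniform pt γ) (hinv : ∀ (j : Fin N) (p : ℝ[X]), p.natDegree ≤ k →
      ∀ m ≤ k, ∀ x ∈ Set.Icc (ptL pt j) (ptR pt j),
      meshSize pt * (meshSize pt ^ m * (pderiv m p).eval x) ^ 2 ≤ K * cip pt j p p)
    {W : ℝ → ℝ} (hper : ∀ x, W (x + 1) = W x) {v p : Fin N → ℝ[X]}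
    (hvp : MemVk k fun j => v j - p j) {B : ℝ}
    (hB : ∀ m ≤ k, ∀ (j : Fin N), ∀ x ∈ Set.Icc (ptL pt j) (ptR pt j),
      |meshSize pt ^ m * ((pderiv m (p j)).eval x - iteratedDeriv m W x)| ≤ B)
    {Bv : ℝ} (hBv : ∀ (j : Fin N), ∀ x ∈ Set.Icc (ptL pt j) (ptR pt j), |(v j).eval x| ≤ Bv)
    {c0 : ℝ} (hc0 : 0 < c0) (hv : c0 ≤ linfSub pt v (avg pt v))
    {β τ CCFL : ℝ} (hβ : 0 ≤ β) (hτ : 0 ≤ τ) (hC : 0 ≤ CCFL) (hCFL : τ ≤ CCFL * meshSize pt)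
    {Pc : Fin N → ℕ → ℝ[X] → ℝ[X]} (hPc : IsCellProj pt Pc) {w : ℝ → Fin N → ℝ[X]}
    (hw : IsDampingSol k pt (fun _ => β) Pc v w) :
    ip pt (fun j => w τ j - v j) (fun j => w τ j - v j) ≤
      (β * CCFL * γ * (k + 1) * ((2 * k + 1) / (2 * c0)) * Bv) ^ 2 * 2 *
      (12 * K * ip pt (fun j => v j - p j) (fun j => v j - p j) + 24 * (γ * B ^ 2)) := by
  have hsum := Finset.sum_le_sum fun j (_ : j ∈ univ) =>
    cip_damping_le hpt hk hγ hinv hper hvp hB hBv hc0 hv hβ hτ hC hCFL hPc hw j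
  have hmesh : ∑ j : Fin N, meshSize pt * B ^ 2 ≤ γ * B ^ 2 := by
    rw [← Finset.sum_mul]
    refine mul_le_mul_of_nonneg_right ?_ (sq_nonneg _)
    have := Finset.sum_le_sum fun j (_ : j ∈ univ) => hγ j
    rwa [← Finset.mul_sum, sum_cellh hpt, mul_one] at this
  rw [← Finset.mul_sum, Finset.sum_add_distrib, ← Finset.mul_sum, ← Finset.mul_sum,
    Finset.sum_add_distrib, Finset.sum_add_distrib, ← Finset.mul_sum,
    sum_sub_one fun j => cip pt j (v j - p j) (v j - p j),
    sum_add_one fun j => cip pt j (v j - p j) (v j - p j)] at hsum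
  refine hsum.trans (mul_le_mul_of_nonneg_left ?_ (by positivity))
  rw [ip]
  linarith

/-- One OEDG step on a quasi-uniform mesh, together with the Gauss–Radau projections `p m` of
the reference functions. -/
structure OEDGStepSetting [NeZero N] (k s r : ℕ) (c d : ℕ → ℕ → ℝ) (β γ CCFL Cr c0 : ℝ)
    (u : ℝ → ℝ → ℝ) (pt : Fin (N + 1) → ℝ) (τ : ℝ) (n : ℕ) (p uh uσ : ℕ → Fin N → ℝ[X]) :
    Prop where
  mesh : IsMesh pt
  quasiUniform : QuasiUniform pt γ
  meshSize_le_one : meshSize pt ≤ 1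
  tau_pos : 0 < τ
  tau_le_one : τ ≤ 1
  cfl : τ ≤ CCFL * meshSize pt
  residual : fl2 (rkRes u c d β τ s n) ≤ Cr * τ ^ r
  radau : ∀ m j, IsGRProj k (ptL pt j) (ptR pt j) (UrefS u c d β τ s n m) (p m j)
  stage : ∃ L, IsDGOp k pt β L ∧ ∀ ℓ < s, uh (ℓ + 1) = rkStage c d τ L uσ ℓ
  damping : ∃ Pc, IsCellProj pt Pc ∧ ∀ ℓ < s, MemVk k (uh (ℓ + 1)) →
    ∃ w, IsDampingSol k pt (fun _ => β) Pc (uh (ℓ + 1)) w ∧ uσ (ℓ + 1) = w τ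
  linfSub_ge : ∀ ℓ < s, c0 ≤ linfSub pt (uh (ℓ + 1)) (avg pt (uh (ℓ + 1)))

lemma ip_add_self_le {pt : Fin (N + 1) → ℝ} (hpt : IsMesh pt) (v w : Fin N → ℝ[X]) :
    ip pt (fun j => v j + w j) (fun j => v j + w j) ≤ 2 * ip pt v v + 2 * ip pt w w := by
  simp only [ip, Finset.mul_sum, ← Finset.sum_add_distrib]
  exact Finset.sum_le_sum fun j _ => cip_add_self_le hpt j (v j) (w j)

lemma linfSub_zero_le [NeZero N] {pt : Fin (N + 1) → ℝ} (hpt : IsMesh pt) {w : Fin N → ℝ[X]}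
    {B : ℝ} (hB : ∀ (j : Fin N), ∀ x ∈ Set.Icc (ptL pt j) (ptR pt j), |(w j).eval x| ≤ B) :
    linfSub pt w 0 ≤ B := by
  refine ciSup_le fun j => csSup_le ?_ ?_
  · exact ⟨_, ptL pt j, ⟨le_rfl, (ptL_lt_ptR hpt j).le⟩, rfl⟩
  · rintro _ ⟨x, hx, rfl⟩
    simpa using hB j x hx

/-- The truncation term of a stage is of the size of the Runge–Kutta residual. -/
lemma integral_stage_residual_le {s r : ℕ} {c d : ℕ → ℕ → ℝ} {β τ Cr : ℝ} {u : ℝ → ℝ → ℝ} {n : ℕ}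
    (hτ0 : 0 < τ) (hτ1 : τ ≤ 1) (hres : fl2 (rkRes u c d β τ s n) ≤ Cr * τ ^ r) (ℓ : ℕ) :
    ∫ x in (0 : ℝ)..1, (if ℓ + 1 = s then τ * rkRes u c d β τ s n x else 0) ^ 2 ≤
      Cr ^ 2 * (τ ^ r) ^ 2 := by
  split_ifs
  · have h0 : 0 ≤ ∫ x in (0 : ℝ)..1, rkRes u c d β τ s n x ^ 2 :=
      intervalIntegral.integral_nonneg zero_le_one fun x _ => sq_nonneg _
    have h1 := pow_le_pow_left₀ (Real.sqrt_nonneg _) hres 2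
    rw [Real.sq_sqrt h0] at h1
    simp only [mul_pow]
    rw [intervalIntegral.integral_const_mul, ← mul_pow]
    exact (mul_le_of_le_one_left h0 (pow_le_one₀ hτ0.le hτ1)).trans h1
  · simp only [ne_eq, OfNat.ofNat_ne_zero, not_false_eq_true, zero_pow,
      intervalIntegral.integral_zero]
    positivity

/-- Propagation of the a priori error bounds through one stage. -/
lemma exists_stage_bound {k s r : ℕ} (hk : 1 ≤ k) (hr : 2 ≤ r) (c d : ℕ → ℕ → ℝ)
    {β γ CCFL Cr c0 : ℝ} (hβ : 0 < β) (hγ : 1 ≤ γ) (hCCFL : 0 < CCFL) (hc0 : 0 < c0)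
    {u : ℝ → ℝ → ℝ} (hu : IsSmoothSolution β u) {ℓ : ℕ} (hℓ : ℓ < s) {A : ℝ} (hA : 0 < A) :
    ∃ A' : ℝ, 0 < A' ∧ ∃ Cb : ℝ, 0 < Cb ∧ ∀ (N : ℕ) [NeZero N] (pt : Fin (N + 1) → ℝ) (τ : ℝ)
      (n : ℕ) (p uh uσ : ℕ → Fin N → ℝ[X]),
      OEDGStepSetting k s r c d β γ CCFL Cr c0 u pt τ n p uh uσ →
      (∀ m ≤ ℓ, MemVk k (uσ m) ∧ ip pt (fun j => uσ m j - p m j) (fun j => uσ m j - p m j) ≤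
        A * (meshSize pt ^ (k + 1) + τ ^ r) ^ 2) → meshSize pt ≤ Cb →
      MemVk k (uσ (ℓ + 1)) ∧
      ip pt (fun j => uσ (ℓ + 1) j - p (ℓ + 1) j) (fun j => uσ (ℓ + 1) j - p (ℓ + 1) j) ≤
        A' * (meshSize pt ^ (k + 1) + τ ^ r) ^ 2 ∧
      linfSub pt (fun j => uh (ℓ + 1) j - p (ℓ + 1) j) 0 ≤ meshSize pt := by
  obtain ⟨K, hK, hinv⟩ := exists_mesh_inverse k hγ
  obtain ⟨M, hM, hMb⟩ := exists_uref_bound hu c d s (k + 1)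
  obtain ⟨M0, hM0, hM0b⟩ := exists_uref_bound hu c d s 0
  obtain ⟨Ka, hKa, happ⟩ := exists_mesh_radau k hγ hM
  set D := ∑ m ∈ range (ℓ + 1), (c ℓ m ^ 2 + d ℓ m ^ 2) with hDdef
  have hD : ∀ m ≤ ℓ, c ℓ m ^ 2 ≤ D ∧ d ℓ m ^ 2 ≤ D := by
    intro m hm
    have := Finset.single_le_sum (f := fun m => c ℓ m ^ 2 + d ℓ m ^ 2) (s := range (ℓ + 1))
      (fun _ _ => by positivity) (mem_range.mpr (Nat.lt_succ_of_le hm))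
    constructor <;> nlinarith [sq_nonneg (c ℓ m), sq_nonneg (d ℓ m)]
  have hD0 : 0 ≤ D := Finset.sum_nonneg fun _ _ => by positivity
  set Q := (3 * ((ℓ : ℝ) + 1) + 2) * (D + 2 * (D * CCFL ^ 2 * (3 * β ^ 2 * (K + K ^ 2)))
    + (((ℓ : ℝ) + 1) * D + 1)) with hQdef
  have hQ : 0 < Q := by positivity
  set Q' := Q * (((ℓ : ℝ) + 1) * A + Ka ^ 2 + Cr ^ 2) with hQ'def
  have hQ' : 0 < Q' := by positivity
  set Z := (β * CCFL * γ * (k + 1) * ((2 * k + 1) / (2 * c0)) * (1 + Ka + M0)) ^ 2 * 2 with hZdef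
  have hZ : 0 ≤ Z := by positivity
  have hγ0 : 0 < γ := by linarith
  refine ⟨2 * (Z * (12 * K * Q' + 24 * (γ * Ka ^ 2))) + 2 * Q', by positivity,
    1 / (K * Q' * (1 + CCFL ^ 2) ^ 2), by positivity, ?_⟩
  intro N _ pt τ n p uh uσ hS hm hCb
  obtain ⟨L, hL, huh⟩ := hS.stage
  obtain ⟨Pc, hPc, hdamp⟩ := hS.damping
  have hpt := hS.mesh
  have hh := meshSize_pos hpt
  have hh1 := hS.meshSize_le_one
  have hτ := hS.tau_pos
  set h := meshSize pt with hhdef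
  set E := h ^ (k + 1) + τ ^ r with hE
  set W := fun m => UrefS u c d β τ s n m with hWdef
  have hW : ∀ m, ContDiff ℝ (⊤ : ℕ∞) (W m) := fun m => (UniformlySmooth.urefS hu c d s m).smooth τ n
  have hper : ∀ m x, W m (x + 1) = W m x := fun m =>
    (UniformlySmooth.urefS hu c d s m).periodic τ n
  have hB : ∀ m ≤ s, ∀ i ≤ k, ∀ j, ∀ x ∈ Set.Icc (ptL pt j) (ptR pt j),
      |h ^ i * ((pderiv i (p m j)).eval x - iteratedDeriv i (W m) x)| ≤ Ka * h ^ (k + 1) :=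
    fun m hms i hi j => happ N pt hpt hS.quasiUniform (W m) (hW m)
      (hMb m hms τ hτ hS.tau_le_one n) j (p m j) (hS.radau m j) i hi
  have hB0 : ∀ m ≤ s, ∀ j, ∀ x ∈ Set.Icc (ptL pt j) (ptR pt j),
      |W m x - (p m j).eval x| ≤ Ka * h ^ (k + 1) := fun m hms j x hx => by
    have := hB m hms 0 (Nat.zero_le _) j x hx
    rwa [pow_zero, one_mul, pderiv_zero, iteratedDeriv_zero, abs_sub_comm] at this
  have hρc := continuous_rkRes hu c d τ s n
  have hx0 := ip_stage_error_le hpt hk hK (hinv N pt hpt hS.quasiUniform) hτ.le hS.cfl hD hW hper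
    hS.radau (fun m hm' => hB0 m (hm'.trans hℓ)) (fun m hm' => (hm m hm').1) hL
    (ρ := fun x => if ℓ + 1 = s then τ * rkRes u c d β τ s n x else 0)
    (by split_ifs <;> fun_prop) (urefS_succ u c d β hτ.ne' n hℓ)
  rw [← huh ℓ hℓ] at hx0
  have hhk : 0 ≤ h ^ (k + 1) := by positivity
  have hτr : 0 ≤ τ ^ r := by positivity
  have hBE : (Ka * h ^ (k + 1)) ^ 2 ≤ Ka ^ 2 * E ^ 2 := by
    rw [mul_pow]
    gcongr
    linarith
  have hρE : ∫ x in (0 : ℝ)..1, (if ℓ + 1 = s then τ * rkRes u c d β τ s n x else 0) ^ 2 ≤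
      Cr ^ 2 * E ^ 2 := by
    refine (integral_stage_residual_le hτ hS.tau_le_one hS.residual ℓ).trans ?_
    gcongr
    linarith
  have hx : ip pt (fun j => uh (ℓ + 1) j - p (ℓ + 1) j) (fun j => uh (ℓ + 1) j - p (ℓ + 1) j) ≤
      Q' * E ^ 2 := by
    have hsum := Finset.sum_le_sum fun m (hm' : m ∈ range (ℓ + 1)) =>
      (hm m (Nat.lt_succ_iff.mp (mem_range.mp hm'))).2
    rw [Finset.sum_const, card_range, nsmul_eq_mul] at hsum
    push_cast at hsum
    refine hx0.trans ?_
    rw [hQ'def, mul_assoc Q]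
    refine mul_le_mul_of_nonneg_left ?_ hQ.le
    linarith
  have huhk : MemVk k (uh (ℓ + 1)) := by
    rw [huh ℓ hℓ]
    exact MemVk.rkStage hL fun m hm' => (hm m hm').1
  have hξk : MemVk k fun j => uh (ℓ + 1) j - p (ℓ + 1) j := fun j =>
    (natDegree_sub_le _ _).trans (max_le (huhk j) (hS.radau _ j).1)
  have hEh : E ≤ (1 + CCFL ^ 2) * h ^ 2 := by
    have h1 : h ^ (k + 1) ≤ h ^ 2 := pow_le_pow_of_le_one hh.le hh1 (by omega)
    have h2 : τ ^ r ≤ (CCFL * h) ^ 2 := (pow_le_pow_of_le_one hτ.le hS.tau_le_one hr).trans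
      (pow_le_pow_left₀ hτ.le hS.cfl 2)
    rw [hE]
    linarith
  have hinf : ∀ (j : Fin N), ∀ x ∈ Set.Icc (ptL pt j) (ptR pt j),
      |(uh (ℓ + 1) j - p (ℓ + 1) j).eval x| ≤ h := by
    intro j x hx'
    have h1 := hinv N pt hpt hS.quasiUniform j _ (hξk j) 0 (Nat.zero_le _) x hx'
    rw [pow_zero, one_mul, pderiv_zero] at h1
    have h2 : cip pt j (uh (ℓ + 1) j - p (ℓ + 1) j) (uh (ℓ + 1) j - p (ℓ + 1) j) ≤
        ip pt (fun j => uh (ℓ + 1) j - p (ℓ + 1) j) (fun j => uh (ℓ + 1) j - p (ℓ + 1) j) :=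
      Finset.single_le_sum (f := fun j => cip pt j (uh (ℓ + 1) j - p (ℓ + 1) j)
        (uh (ℓ + 1) j - p (ℓ + 1) j)) (fun i _ => cip_self_nonneg hpt i _) (mem_univ j)
    rw [le_div_iff₀ (by positivity)] at hCb
    refine abs_le_of_sq_le_sq (le_of_mul_le_mul_left (h1.trans ?_) hh) hh.le
    calc K * cip pt j (uh (ℓ + 1) j - p (ℓ + 1) j) (uh (ℓ + 1) j - p (ℓ + 1) j)
        ≤ K * (Q' * ((1 + CCFL ^ 2) * h ^ 2) ^ 2) := by
          refine mul_le_mul_of_nonneg_left (h2.trans (hx.trans ?_)) hK.le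
          gcongr
      _ = (h * (K * Q' * (1 + CCFL ^ 2) ^ 2)) * (h * h ^ 2) := by ring
      _ ≤ h * h ^ 2 := mul_le_of_le_one_left (by positivity) hCb
  have hBv : ∀ (j : Fin N), ∀ x ∈ Set.Icc (ptL pt j) (ptR pt j),
      |(uh (ℓ + 1) j).eval x| ≤ 1 + Ka + M0 := by
    intro j x hx'
    have h1 := abs_le.mp (hinf j x hx')
    have h2 := abs_le.mp (hB0 (ℓ + 1) hℓ j x hx')
    have h3 := hM0b (ℓ + 1) hℓ τ hτ hS.tau_le_one n x
    rw [iteratedDeriv_zero] at h3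
    have h3 := abs_le.mp h3
    rw [eval_sub] at h1
    have h4 : Ka * h ^ (k + 1) ≤ Ka := mul_le_of_le_one_right hKa.le (pow_le_one₀ hh.le hh1)
    simp only [hWdef] at h2
    exact abs_le.mpr ⟨by linarith, by linarith⟩
  obtain ⟨w, hw, hwτ⟩ := hdamp ℓ hℓ huhk
  have hd := ip_damping_le hpt hk hS.quasiUniform (hinv N pt hpt hS.quasiUniform) (hper (ℓ + 1))
    hξk (hB (ℓ + 1) hℓ) hBv hc0 (hS.linfSub_ge ℓ hℓ) hβ.le hτ.le hCCFL.le hS.cfl hPc hw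
  refine ⟨?_, ?_, linfSub_zero_le hpt hinf⟩
  · rw [hwτ]
    exact hw.2.1 τ
  · have hadd := ip_add_self_le hpt (fun j => w τ j - uh (ℓ + 1) j)
      (fun j => uh (ℓ + 1) j - p (ℓ + 1) j)
    simp only [sub_add_sub_cancel] at hadd
    rw [hwτ]
    have hd' : ip pt (fun j => w τ j - uh (ℓ + 1) j) (fun j => w τ j - uh (ℓ + 1) j) ≤
        Z * ((12 * K * Q' + 24 * (γ * Ka ^ 2)) * E ^ 2) := by
      refine hd.trans (mul_le_mul_of_nonneg_left ?_ hZ)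
      have h1 := mul_le_mul_of_nonneg_left hx (by positivity : 0 ≤ 12 * K)
      have h2 := mul_le_mul_of_nonneg_left hBE hγ0.le
      linarith
    linarith

/-- The a priori error bounds hold for all stages of a step. -/
lemma exists_step_bound {k s r : ℕ} (hk : 1 ≤ k) (hr : 2 ≤ r) (c d : ℕ → ℕ → ℝ)
    {β γ CCFL Cr c0 A₀ : ℝ} (hβ : 0 < β) (hγ : 1 ≤ γ) (hCCFL : 0 < CCFL) (hc0 : 0 < c0)
    {u : ℝ → ℝ → ℝ} (hu : IsSmoothSolution β u) (hA₀ : 0 < A₀) {ℓ : ℕ} (hℓ : ℓ ≤ s) :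
    ∃ A : ℝ, 0 < A ∧ ∃ Cb : ℝ, 0 < Cb ∧ ∀ (N : ℕ) [NeZero N] (pt : Fin (N + 1) → ℝ) (τ : ℝ)
      (n : ℕ) (p uh uσ : ℕ → Fin N → ℝ[X]),
      OEDGStepSetting k s r c d β γ CCFL Cr c0 u pt τ n p uh uσ → MemVk k (uσ 0) →
      ip pt (fun j => uσ 0 j - p 0 j) (fun j => uσ 0 j - p 0 j) ≤
        A₀ * (meshSize pt ^ (k + 1) + τ ^ r) ^ 2 → meshSize pt ≤ Cb →
      ∀ m ≤ ℓ, (MemVk k (uσ m) ∧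
        ip pt (fun j => uσ m j - p m j) (fun j => uσ m j - p m j) ≤
          A * (meshSize pt ^ (k + 1) + τ ^ r) ^ 2) ∧
        (1 ≤ m → linfSub pt (fun j => uh m j - p m j) 0 ≤ meshSize pt) := by
  induction ℓ with
  | zero =>
    refine ⟨A₀, hA₀, 1, one_pos, fun N _ pt τ n p uh uσ _ h0 h1 _ m hm => ?_⟩
    obtain rfl : m = 0 := by omega
    exact ⟨⟨h0, h1⟩, fun h => absurd h (by omega)⟩
  | succ ℓ ih =>
    obtain ⟨A, hA, Cb, hCb, hind⟩ := ih (by omega)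
    obtain ⟨A', hA', Cb', hCb', hstep⟩ := exists_stage_bound (Cr := Cr) hk hr c d hβ hγ hCCFL hc0
      hu (Nat.lt_of_succ_le hℓ) hA
    refine ⟨max A A', lt_max_of_lt_left hA, min Cb Cb', lt_min hCb hCb',
      fun N _ pt τ n p uh uσ hS h0 h1 hmesh m hm => ?_⟩
    have hprev := hind N pt τ n p uh uσ hS h0 h1 (hmesh.trans (min_le_left _ _))
    rcases Nat.lt_or_ge ℓ m with hlt | hge
    · obtain rfl : m = ℓ + 1 := by omega
      obtain ⟨s1, s2, s3⟩ := hstep N pt τ n p uh uσ hS (fun m hm => (hprev m hm).1)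
        (hmesh.trans (min_le_right _ _))
      exact ⟨⟨s1, s2.trans (mul_le_mul_of_nonneg_right (le_max_right _ _) (sq_nonneg _))⟩,
        fun _ => s3⟩
    · obtain ⟨⟨s1, s2⟩, s3⟩ := hprev m hge
      exact ⟨⟨s1, s2.trans (mul_le_mul_of_nonneg_right (le_max_left _ _) (sq_nonneg _))⟩, s3⟩

/-- Lemma 4.5, 1D case, `d = 1`.  Suppose `k ≥ 1` (`k > d/2`) and
`r ≥ 2` (`r > d/2 + 1`).  If `‖ξ_σ^n‖ ≤ C⋆⋆ (h^{k+1} + τ^r)`, then there exist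
constants `C` and `C̄⋆⋆` (depending on `C⋆⋆`) such that whenever `h ≤ C̄⋆⋆` one has
`‖ξ_σ^{n,ℓ}‖ ≤ C (h^{k+1} + τ^r)` and `‖ξ^{n,ℓ}‖_{L∞(Ω)} ≤ h` for all `1 ≤ ℓ ≤ s`. -/
theorem a_priori_validation
    (k s r : ℕ) (hk : 1 ≤ k) (hr : 2 ≤ r) (hs : 1 ≤ s)
    (c d : ℕ → ℕ → ℝ) (hc : ∀ ℓ < s, ∑ m ∈ Finset.range (ℓ+1), c ℓ m = 1)
    (β γ CCFL κ Cr c0 Css : ℝ)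
    (hβ : 0 < β) (hγ : 1 ≤ γ) (hCCFL : 0 < CCFL) (hκ : 1 ≤ κ) (hCr : 0 ≤ Cr)
    (hc0 : 0 < c0) (hCss : 0 < Css)
    (u : ℝ → ℝ → ℝ) (hu : IsSmoothSolution β u) :
    ∃ C : ℝ, 0 < C ∧ ∃ Cbar : ℝ, 0 < Cbar ∧
      ∀ (N : ℕ) [NeZero N] (pt : Fin (N+1) → ℝ),
        IsMesh pt → QuasiUniform pt γ → meshSize pt ≤ 1 →
      ∀ τ : ℝ, 0 < τ → τ ≤ 1 → τ ≤ CCFL * meshSize pt ^ κ →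
      ∀ n : ℕ, fl2 (rkRes u c d β τ s n) ≤ Cr * τ ^ r →
      ∀ Pstar : (ℝ → ℝ) → Fin N → Polynomial ℝ,
        (∀ W : ℝ → ℝ, Continuous W → ∀ j,
          IsGRProj k (ptL pt j) (ptR pt j) W (Pstar W j)) →
      ∀ Pc : Fin N → ℕ → Polynomial ℝ → Polynomial ℝ, IsCellProj pt Pc →
      ∀ L Fτ : (Fin N → Polynomial ℝ) → (Fin N → Polynomial ℝ),
        IsDGOp k pt β L → IsOEOp k pt (fun _ => β) Pc τ Fτ →
      ∀ (un : Fin N → Polynomial ℝ) (uh uσ : ℕ → Fin N → Polynomial ℝ),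
        MemVk k un → IsOEDGStep s c d τ L Fτ un uh uσ →
        (∀ m, 1 ≤ m → m ≤ s → c0 ≤ linfSub pt (uh m) (avg pt (uh m))) →
        l2 pt (fun j => uσ 0 j - Pstar (UrefS u c d β τ s n 0) j)
          ≤ Css * (meshSize pt ^ (k+1) + τ ^ r) →
        meshSize pt ≤ Cbar →
        ∀ ℓ, 1 ≤ ℓ → ℓ ≤ s →
          l2 pt (fun j => uσ ℓ j - Pstar (UrefS u c d β τ s n ℓ) j)
            ≤ C * (meshSize pt ^ (k+1) + τ ^ r) ∧
          linfSub pt (fun j => uh ℓ j - Pstar (UrefS u c d β τ s n ℓ) j) 0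
            ≤ meshSize pt := by
  obtain ⟨A, hA, Cb, hCb, hstep⟩ := exists_step_bound (Cr := Cr) (s := s) hk hr c d hβ hγ hCCFL hc0
    hu (pow_pos hCss 2) le_rfl
  refine ⟨Real.sqrt A, Real.sqrt_pos.mpr hA, Cb, hCb, ?_⟩
  intro N _ pt hpt hq hh1 τ hτ hτ1 hcfl n hres Pstar hP Pc hPc L Fτ hL hF un uh uσ hun hst hlinf
    hstart hmesh ℓ hℓ1 hℓs
  have hh := meshSize_pos hpt
  have hE : 0 ≤ meshSize pt ^ (k + 1) + τ ^ r := by positivity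
  have hS : OEDGStepSetting k s r c d β γ CCFL Cr c0 u pt τ n
      (fun m => Pstar (UrefS u c d β τ s n m)) uh uσ :=
    { mesh := hpt
      quasiUniform := hq
      meshSize_le_one := hh1
      tau_pos := hτ
      tau_le_one := hτ1
      cfl := hcfl.trans (mul_le_mul_of_nonneg_left
        (Real.rpow_le_self_of_le_one hh.le hh1 hκ) hCCFL.le)
      residual := hres
      radau := fun m => hP _ ((UniformlySmooth.urefS hu c d s m).smooth τ n).continuous
      stage := ⟨L, hL, fun ℓ hℓ => (hst.2 ℓ hℓ).1⟩
      damping := ⟨Pc, hPc, fun ℓ hℓ hmem => by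
        obtain ⟨w, hw, hw'⟩ := hF _ hmem
        exact ⟨w, hw, (hst.2 ℓ hℓ).2.trans hw'⟩⟩
      linfSub_ge := fun ℓ hℓ => hlinf (ℓ + 1) (by omega) hℓ }
  have hstart' := pow_le_pow_left₀ (Real.sqrt_nonneg _) hstart 2
  rw [Real.sq_sqrt (ip_self_nonneg hpt _), mul_pow] at hstart'
  obtain ⟨⟨_, h1⟩, h2⟩ := hstep N pt τ n _ uh uσ hS (hst.1 ▸ hun) hstart' hmesh ℓ hℓs
  refine ⟨?_, h2 hℓ1⟩
  rw [l2]
  refine (Real.sqrt_le_sqrt h1).trans_eq ?_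
  rw [Real.sqrt_mul hA.le, Real.sqrt_sq hE]

end OEDG
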